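/- arXiv:1407.1591 — 4 statements merged into one kernel-verified Lean document; each statement's English description precedes it below -/
import Mathlib

section
/- Let C > 0 be a constant and let a_n, b_n be sequences with C^{-1} ≤ a_n, b_n ≤ C for all sufficiently large n. Set p_n = a_n (log n)/n and q_n = b_n (log n)/n. Then n · P(n, p_n, q_n) → 0 as n → ∞ if and only if (a_n + b_n − 2√(a_n b_n) − 1) log n + (1/2) log log n → ∞. -/
open Real Filter

/-- Probability that a Binomial(m, p) random variable equals `k`. -/
noncomputable def binomProb (m : ℕ) (p : ℝ) (k : ℕ) : ℝ :=
  (m.choose k : ℝ) * p ^ k * (1 - p) ^ (m - k)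

/-- For independent `X ~ Binomial(m, p)` and `Y ~ Binomial(n, q)`,
the probability `Pr(Y ≥ X - ℓ)`. -/
noncomputable def prGEshift (m : ℕ) (p : ℝ) (n : ℕ) (q : ℝ) (ℓ : ℝ) : ℝ :=
  ∑ j ∈ Finset.range (m + 1), ∑ k ∈ Finset.range (n + 1),
    if (j : ℝ) - ℓ ≤ (k : ℝ) then binomProb m p j * binomProb n q k else 0

/-- For independent `X ~ Binomial(m, p)` and `Y ~ Binomial(n, q)`,
the probability `Pr(Y ≥ X)`. -/
noncomputable def prGE (m : ℕ) (p : ℝ) (n : ℕ) (q : ℝ) : ℝ :=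
  prGEshift m p n q 0

/-- `P(m, n, p, q) = Pr(Y ≥ X)` for independent `X ~ Binomial(m, max p q)`
and `Y ~ Binomial(n, min p q)`. -/
noncomputable def Pmn (m n : ℕ) (p q : ℝ) : ℝ :=
  prGE m (max p q) n (min p q)

/-- `P(n, p, q) = P(n, n, p, q)`. -/
noncomputable def Pn (n : ℕ) (p q : ℝ) : ℝ :=
  Pmn n n p q

theorem pois_le (x : ℝ) (hx : 1 ≤ x) (k : ℕ) : x ^ k / (k.factorial : ℝ) ≤ x ^ ⌊x⌋₊ / (⌊x⌋₊.factorial : ℝ) := by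
  have hx0 : 0 < x := by linarith
  rcases le_total k ⌊x⌋₊ with h | h
  · have : ∀ m : ℕ, k ≤ m → m ≤ ⌊x⌋₊ → x ^ k / (k.factorial : ℝ) ≤ x ^ m / (m.factorial : ℝ) := by
      intro m hm
      induction m, hm using Nat.le_induction with
      | base => intro _; exact le_rfl
      | succ m hm ih =>
        intro h2
        refine (ih (by omega)).trans ?_
        have h3 : ((m + 1 : ℕ) : ℝ) ≤ x := (Nat.cast_le.mpr h2).trans (Nat.floor_le hx0.le)
        rw [Nat.factorial_succ, pow_succ, Nat.cast_mul, div_le_div_iff₀ (by positivity) (by positivity)]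
        have : 0 ≤ x ^ m * (m.factorial : ℝ) := by positivity
        nlinarith
    exact this _ h le_rfl
  · induction k, h using Nat.le_induction with
    | base => exact le_rfl
    | succ m hm ih =>
      refine le_trans ?_ ih
      have h3 : x ≤ ((m + 1 : ℕ) : ℝ) := by
        have := Nat.lt_floor_add_one x
        have h4 : ((⌊x⌋₊ : ℕ) : ℝ) ≤ m := Nat.cast_le.mpr hm
        push_cast; linarith
      rw [Nat.factorial_succ, pow_succ, Nat.cast_mul, div_le_div_iff₀ (by positivity) (by positivity)]
      have : 0 ≤ x ^ m * (m.factorial : ℝ) := by positivity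
      nlinarith

theorem pois_max (x : ℝ) (hx : 1 ≤ x) (k : ℕ) : x ^ k / (k.factorial : ℝ) ≤ Real.exp x / √x := by
  refine (pois_le x hx k).trans ?_
  have hx0 : 0 < x := by linarith
  set m := ⌊x⌋₊ with hm
  have hm1 : 1 ≤ m := Nat.le_floor (by simpa using hx)
  have hm1' : (1 : ℝ) ≤ m := by exact_mod_cast hm1
  have hm0 : (0 : ℝ) < m := by linarith
  have hmx : x < m + 1 := Nat.lt_floor_add_one x
  have hst := Stirling.le_factorial_stirling m
  have hsq : √x ≤ √(2 * Real.pi * m) := by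
    apply Real.sqrt_le_sqrt
    nlinarith [Real.pi_gt_three]
  have h1 : x ^ m ≤ Real.exp x * (m / Real.exp 1) ^ m := by
    have : x / m ≤ Real.exp (x / m - 1) := by
      have := Real.add_one_le_exp (x / m - 1); linarith
    have h2 : (x / m) ^ m ≤ Real.exp (x - m) := by
      calc (x / m) ^ m ≤ (Real.exp (x / m - 1)) ^ m := by gcongr
        _ = Real.exp (x - m) := by
          rw [← Real.exp_nat_mul]; congr 1; field_simp
    rw [div_pow, div_le_iff₀ (by positivity), Real.exp_sub] at h2
    rw [div_pow, ← Real.exp_nat_mul, mul_one]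
    calc _ ≤ _ := h2
      _ = _ := by ring
  rw [div_le_div_iff₀ (by positivity) (by positivity)]
  calc x ^ m * √x ≤ (Real.exp x * (m / Real.exp 1) ^ m) * √(2 * Real.pi * m) := by gcongr
    _ = Real.exp x * (√(2 * Real.pi * m) * (m / Real.exp 1) ^ m) := by ring
    _ ≤ _ := by gcongr

theorem bessel_upper (x : ℝ) (hx : 1 ≤ x) (n : ℕ) :
    ∑ k ∈ Finset.range (n + 1), (x ^ k / (k.factorial : ℝ)) ^ 2 ≤ Real.exp x * (Real.exp x / √x) := by
  have hx0 : 0 < x := by linarith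
  calc _ ≤ ∑ k ∈ Finset.range (n + 1), (x ^ k / (k.factorial : ℝ)) * (Real.exp x / √x) := by
        apply Finset.sum_le_sum
        intro k _
        rw [sq]
        have := pois_max x hx k
        gcongr
    _ ≤ _ := by
        rw [← Finset.sum_mul]
        gcongr
        exact Real.sum_le_exp_of_nonneg hx0.le _

theorem double_sum (u : ℕ → ℝ) (r : ℝ) (hr : 0 ≤ r) (hr1 : r < 1) (N : ℕ) :
    ∑ j ∈ Finset.range N, ∑ k ∈ Finset.range N, (if j ≤ k then u j * u k * r ^ (k - j) else 0)
      ≤ (1 / (1 - r)) * ∑ k ∈ Finset.range N, u k ^ 2 := by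
  have hg : ∀ s : Finset ℕ, ∑ i ∈ s, r ^ i ≤ 1 / (1 - r) := by
    intro s
    rw [one_div]
    exact sum_le_hasSum s (fun i _ => by positivity) (hasSum_geometric_of_lt_one hr hr1)
  have g1 : ∀ j, ∑ k ∈ Finset.range N, (if j ≤ k then r ^ (k - j) else 0) ≤ 1 / (1 - r) := by
    intro j
    rw [← Finset.sum_filter]
    rw [← Finset.sum_image (f := fun i => r ^ i) (g := fun k => k - j)]
    · exact hg _
    · intro x hx y hy h
      simp at hx hy h; omega
  have g2 : ∀ k, ∑ j ∈ Finset.range N, (if j ≤ k then r ^ (k - j) else 0) ≤ 1 / (1 - r) := by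
    intro k
    rw [← Finset.sum_filter]
    rw [← Finset.sum_image (f := fun i => r ^ i) (g := fun j => k - j)]
    · exact hg _
    · intro x hx y hy h
      simp at hx hy h; omega
  calc _ ≤ ∑ j ∈ Finset.range N, ∑ k ∈ Finset.range N,
        (u j ^ 2 / 2 * (if j ≤ k then r ^ (k - j) else 0) + u k ^ 2 / 2 * (if j ≤ k then r ^ (k - j) else 0)) := by
        apply Finset.sum_le_sum; intro j _
        apply Finset.sum_le_sum; intro k _
        split_ifs
        · have : 0 ≤ r ^ (k - j) := by positivity
          nlinarith [mul_nonneg this (sq_nonneg (u j - u k))]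
        · simp
    _ = ∑ j ∈ Finset.range N, u j ^ 2 / 2 * (∑ k ∈ Finset.range N, (if j ≤ k then r ^ (k - j) else 0))
        + ∑ k ∈ Finset.range N, u k ^ 2 / 2 * (∑ j ∈ Finset.range N, (if j ≤ k then r ^ (k - j) else 0)) := by
        simp_rw [Finset.sum_add_distrib, Finset.mul_sum]
        congr 1
        rw [Finset.sum_comm]
    _ ≤ ∑ j ∈ Finset.range N, u j ^ 2 / 2 * (1 / (1 - r)) + ∑ k ∈ Finset.range N, u k ^ 2 / 2 * (1 / (1 - r)) := by
        gcongr with j _ k _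
        · exact g1 j
        · exact g2 k
    _ = _ := by
        rw [← Finset.sum_add_distrib, Finset.mul_sum]
        apply Finset.sum_congr rfl; intro k _; ring

theorem binom_upper (n k : ℕ) (hk : k ≤ n) (p : ℝ) (hp : 0 ≤ p) (hp1 : p ≤ 1) :
    binomProb n p k ≤ (n * p * Real.exp p) ^ k / (k.factorial : ℝ) * Real.exp (-(n * p)) := by
  unfold binomProb
  have h1 : (n.choose k : ℝ) ≤ n ^ k / (k.factorial : ℝ) := Nat.choose_le_pow_div k n
  have h2 : (1 - p) ^ (n - k) ≤ Real.exp p ^ k * Real.exp (-(n * p)) := by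
    calc (1 - p) ^ (n - k) ≤ (Real.exp (-p)) ^ (n - k) := by
          apply pow_le_pow_left₀
          · linarith
          · have := Real.add_one_le_exp (-p); linarith
      _ = _ := by
          rw [← Real.exp_nat_mul, ← Real.exp_nat_mul, ← Real.exp_add, Nat.cast_sub hk]
          congr 1; ring
  have h3 : 0 ≤ (1 - p) ^ (n - k) := pow_nonneg (by linarith) _
  calc _ ≤ (n ^ k / (k.factorial : ℝ)) * p ^ k * (Real.exp p ^ k * Real.exp (-(n * p))) := by gcongr
    _ = _ := by rw [mul_pow, mul_pow]; ring

theorem binomProb_nonneg' (n k : ℕ) (p : ℝ) (hp : 0 ≤ p) (hp1 : p ≤ 1) : 0 ≤ binomProb n p k := by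
  unfold binomProb
  have : 0 ≤ 1 - p := by linarith
  positivity

theorem binom_lower (n k : ℕ) (hn : 0 < n) (hk : 2 * (k : ℝ) ^ 2 ≤ n) (p : ℝ) (hp : 0 ≤ p) (hp1 : p ≤ 1)
    (hp2 : 2 * n * p ^ 2 ≤ 1) :
    1 / 4 * ((n * p) ^ k / (k.factorial : ℝ) * Real.exp (-(n * p))) ≤ binomProb n p k := by
  have hn0 : (0 : ℝ) < n := by exact_mod_cast hn
  have hkn : k ≤ n := by
    have : 2 * k ^ 2 ≤ n := by exact_mod_cast hk
    nlinarith
  have hkn' : (k : ℝ) ≤ n := by exact_mod_cast hkn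
  have h1 : 1 / 2 * (n : ℝ) ^ k / (k.factorial : ℝ) ≤ (n.choose k : ℝ) := by
    rw [div_le_iff₀ (by positivity)]
    have e1 : (n.choose k : ℝ) * (k.factorial : ℝ) = (n.descFactorial k : ℝ) := by
      rw [Nat.descFactorial_eq_factorial_mul_choose]; push_cast; ring
    rw [e1]
    have e2 : ((n + 1 - k : ℕ) : ℝ) ^ k ≤ (n.descFactorial k : ℝ) := by
      exact_mod_cast Nat.pow_sub_le_descFactorial n k
    refine le_trans ?_ e2
    have e3 : (n : ℝ) - k ≤ ((n + 1 - k : ℕ) : ℝ) := by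
      rw [Nat.cast_sub (by omega)]; push_cast; linarith
    have e4 : (n : ℝ) * (1 - k / n) = n - k := by field_simp
    have e6 : (k : ℝ) / n ≤ 1 := by rw [div_le_one hn0]; exact hkn'
    have e5 : 1 / 2 ≤ (1 - (k : ℝ) / n) ^ k := by
      have := one_add_mul_le_pow (a := -((k : ℝ) / n)) (by linarith) k
      have e7 : (k : ℝ) * -((k : ℝ) / n) = - ((k : ℝ) ^ 2 / n) := by ring
      have e8 : (k : ℝ) ^ 2 / n ≤ 1 / 2 := by rw [div_le_iff₀ hn0]; linarith
      rw [e7] at this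
      rw [← sub_eq_add_neg] at this
      rw [← sub_eq_add_neg] at this
      linarith
    calc 1 / 2 * (n : ℝ) ^ k ≤ (1 - (k : ℝ) / n) ^ k * n ^ k := by gcongr
      _ = (n - k) ^ k := by rw [← mul_pow, mul_comm, e4]
      _ ≤ _ := by
        gcongr
  have h2 : 1 / 2 * Real.exp (-(n * p)) ≤ (1 - p) ^ (n - k) := by
    have f1 : (1 - p ^ 2) * Real.exp (-p) ≤ 1 - p := by
      have : (1 + p) * Real.exp (-p) ≤ 1 := by
        rw [Real.exp_neg, ← div_eq_mul_inv, div_le_one (Real.exp_pos _)]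
        have := Real.add_one_le_exp p; linarith
      nlinarith
    have f2 : 1 / 2 ≤ (1 - p ^ 2) ^ n := by
      have := one_add_mul_le_pow (a := -(p ^ 2)) (by nlinarith) n
      rw [← sub_eq_add_neg] at this
      nlinarith
    calc 1 / 2 * Real.exp (-(n * p)) ≤ (1 - p ^ 2) ^ n * Real.exp (-(n * p)) := by gcongr
      _ = ((1 - p ^ 2) * Real.exp (-p)) ^ n := by
        rw [mul_pow, ← Real.exp_nat_mul]; congr 2; ring
      _ ≤ (1 - p) ^ n := by
        apply pow_le_pow_left₀ _ f1
        have : 0 ≤ 1 - p ^ 2 := by nlinarith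
        positivity
      _ ≤ _ := pow_le_pow_of_le_one (by linarith) (by linarith) (by omega)
  unfold binomProb
  calc _ = (1 / 2 * (n : ℝ) ^ k / (k.factorial : ℝ)) * p ^ k * (1 / 2 * Real.exp (-(n * p))) := by
        rw [mul_pow]; ring
    _ ≤ _ := by gcongr

theorem cheb (x : ℝ) (hx : 0 < x) :
    3 / 4 * Real.exp x ≤ ∑ k ∈ Finset.Icc ⌈x - 2 * √x⌉₊ ⌊x + 2 * √x⌋₊, x ^ k / (k.factorial : ℝ) := by
  have s0 : HasSum (fun k : ℕ => x ^ k / (k.factorial : ℝ)) (Real.exp x) := by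
    rw [Real.exp_eq_exp_ℝ]; exact NormedSpace.expSeries_div_hasSum_exp x
  have s1 : HasSum (fun k : ℕ => (k : ℝ) * (x ^ k / (k.factorial : ℝ))) (x * Real.exp x) := by
    rw [← hasSum_nat_add_iff' 1]
    simp only [Finset.range_one, Finset.sum_singleton, Nat.cast_zero, zero_mul, sub_zero]
    refine (s0.mul_left x).congr_fun ?_
    intro k
    rw [Nat.factorial_succ]; push_cast; field_simp; try ring
  have s2 : HasSum (fun k : ℕ => (k : ℝ) ^ 2 * (x ^ k / (k.factorial : ℝ))) (x * (x * Real.exp x + Real.exp x)) := by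
    rw [← hasSum_nat_add_iff' 1]
    simp only [Finset.range_one, Finset.sum_singleton, Nat.cast_zero, zero_mul, sub_zero, ne_eq, OfNat.ofNat_ne_zero, not_false_eq_true, zero_pow]
    refine ((s1.add s0).mul_left x).congr_fun ?_
    intro k
    rw [Nat.factorial_succ]; push_cast; field_simp; try ring
  have s3 : HasSum (fun k : ℕ => (((k : ℝ) - x) ^ 2 / (4 * x) - 1) * (x ^ k / (k.factorial : ℝ))) (-(3 / 4 * Real.exp x)) := by
    have := (((s2.add (s1.mul_left (-2 * x))).add (s0.mul_left (x ^ 2))).mul_left (1 / (4 * x))).sub s0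
    convert this using 1
    · rfl
    · funext k
      field_simp
      ring
    · field_simp
      ring
  have hs := Real.sq_sqrt hx.le
  have h := sum_le_hasSum (Finset.Icc ⌈x - 2 * √x⌉₊ ⌊x + 2 * √x⌋₊) ?_ s3
  · have h2 : -∑ k ∈ Finset.Icc ⌈x - 2 * √x⌉₊ ⌊x + 2 * √x⌋₊, x ^ k / (k.factorial : ℝ) ≤ ∑ k ∈ Finset.Icc ⌈x - 2 * √x⌉₊ ⌊x + 2 * √x⌋₊, (((k : ℝ) - x) ^ 2 / (4 * x) - 1) * (x ^ k / (k.factorial : ℝ)) := by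
      rw [← Finset.sum_neg_distrib]
      apply Finset.sum_le_sum
      intro k _
      have : 0 ≤ ((k : ℝ) - x) ^ 2 / (4 * x) * (x ^ k / (k.factorial : ℝ)) := by positivity
      linarith
    linarith
  · intro k hk
    apply mul_nonneg _ (by positivity)
    rw [sub_nonneg, le_div_iff₀ (by positivity), one_mul]
    have h0 : 0 < √x := Real.sqrt_pos.mpr hx
    rw [Finset.mem_Icc, not_and_or, Nat.ceil_le, Nat.le_floor_iff (by positivity)] at hk
    rcases hk with hk | hk
    · nlinarith
    · nlinarith

theorem bessel_lower (x : ℝ) (hx : 1 ≤ x) :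
    1 / 10 * (Real.exp x * (Real.exp x / √x)) ≤
      ∑ k ∈ Finset.Icc ⌈x - 2 * √x⌉₊ ⌊x + 2 * √x⌋₊, (x ^ k / (k.factorial : ℝ)) ^ 2 := by
  have hx0 : 0 < x := by linarith
  have hs : 1 ≤ √x := by rw [Real.one_le_sqrt]; exact hx
  set W := Finset.Icc ⌈x - 2 * √x⌉₊ ⌊x + 2 * √x⌋₊ with hW
  have h1 := cheb x hx0
  have h2 := sq_sum_le_card_mul_sum_sq (s := W) (f := fun k => x ^ k / (k.factorial : ℝ))
  have h3 : (W.card : ℝ) ≤ 5 * √x := by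
    rw [hW, Nat.card_Icc]
    have c1 := Nat.floor_le (a := x + 2 * √x) (by positivity)
    have c2 := Nat.le_ceil (x - 2 * √x)
    rcases le_total ⌈x - 2 * √x⌉₊ (⌊x + 2 * √x⌋₊ + 1) with h | h
    · rw [Nat.cast_sub h]; push_cast; linarith
    · rw [Nat.sub_eq_zero_of_le h]; push_cast; linarith
  set S := ∑ k ∈ W, (x ^ k / (k.factorial : ℝ)) ^ 2 with hS
  have hS0 : 0 ≤ S := Finset.sum_nonneg (fun _ _ => sq_nonneg _)
  have h4 : (3 / 4 * Real.exp x) ^ 2 ≤ 5 * √x * S := by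
    calc _ ≤ (∑ k ∈ W, x ^ k / (k.factorial : ℝ)) ^ 2 := by gcongr
      _ ≤ _ := h2
      _ ≤ _ := by gcongr
  have e : 1 / 10 * (Real.exp x * (Real.exp x / √x)) = (Real.exp x ^ 2 / 10) / √x := by ring
  rw [e, div_le_iff₀ (by positivity)]
  nlinarith [Real.exp_pos x]

theorem pow_ident (s1 s2 : ℝ) (h : s1 ≠ 0) (j d : ℕ) :
    (s1 ^ 2) ^ j * (s2 ^ 2) ^ (j + d) = (s1 * s2) ^ j * (s1 * s2) ^ (j + d) * (s2 / s1) ^ d := by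
  have h1 : (s1 * s2) ^ d * (s2 / s1) ^ d = (s2 ^ 2) ^ d := by
    rw [← mul_pow]; congr 1; field_simp
  rw [pow_add, pow_add, mul_assoc ((s1 * s2) ^ j), mul_assoc ((s1 * s2) ^ j) ((s1 * s2) ^ d), h1]
  ring

theorem ratio_bound (C α β : ℝ) (hC : 1 ≤ C) (hβ0 : 0 < β) (hβα : β ≤ α)
    (hα : α ≤ C) (hD : 1 / 2 ≤ α + β - 2 * √(α * β)) : 1 / (2 * C) ≤ 1 - √β / √α := by
  have hα0 : 0 < α := by linarith
  have hC0 : 0 < C := by linarith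
  have hsa : 0 < √α := Real.sqrt_pos.mpr hα0
  have h1 : √(α * β) = √α * √β := Real.sqrt_mul hα0.le _
  have h2 := Real.sq_sqrt hα0.le
  have h3 := Real.sq_sqrt hβ0.le
  have h4 : √β ≤ √α := Real.sqrt_le_sqrt hβα
  have h5 : 1 / 2 ≤ (√α - √β) ^ 2 := by rw [h1] at hD; nlinarith only [hD, h2, h3]
  have h6 : 1 / 2 ≤ √α - √β := by nlinarith only [h5, h4]
  have h7 : √α ≤ C := by
    rw [Real.sqrt_le_left hC0.le]; nlinarith only [hα, hC]
  have h8 : 1 / (2 * C) ≤ (√α - √β) / √α := by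
    rw [div_le_div_iff₀ (by positivity) hsa]
    nlinarith only [h6, h7, hC0]
  have h9 : (√α - √β) / √α = 1 - √β / √α := by field_simp
  linarith

theorem exp_le_lin (t : ℝ) (ht : t ≤ 1 / 2) (ht0 : 0 < t) :
    Real.exp t ≤ 1 + 2 * t := by
  have h3 : 1 - t ≤ Real.exp (-t) := Real.one_sub_le_exp_neg t
  have h4 : Real.exp t * Real.exp (-t) = 1 := by rw [← Real.exp_add]; simp
  have h5 := Real.exp_pos t
  have h6 : Real.exp t * (1 - t) ≤ 1 := by
    calc _ ≤ Real.exp t * Real.exp (-t) := by gcongr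
      _ = 1 := h4
  have h7 : 1 ≤ (1 + 2 * t) * (1 - t) := by nlinarith
  exact le_of_mul_le_mul_right (h6.trans h7) (by linarith)

set_option maxHeartbeats 1000000 in
theorem prGE_upper (C α β L : ℝ) (n : ℕ) (hC : 1 ≤ C) (hβ : C⁻¹ ≤ β) (hβα : β ≤ α)
    (hα : α ≤ C) (hL : C ≤ L) (hLn : 18 * C ^ 2 * L ^ 2 ≤ n)
    (hD : 1 / 2 ≤ α + β - 2 * √(α * β)) :
    prGE n (α * L / n) n (β * L / n) ≤
      (2 * C * √C * Real.exp 2) * (Real.exp (-(α + β - 2 * √(α * β)) * L) / √L) := by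
  have hC0 : 0 < C := by linarith
  have hL0 : 0 < L := by linarith
  have hβ0 : 0 < β := lt_of_lt_of_le (by positivity) hβ
  have hα0 : 0 < α := by linarith
  have hCL : 1 ≤ C * L := by nlinarith
  have hn0 : (0 : ℝ) < n := lt_of_lt_of_le (by positivity) hLn
  have hCLn : 18 * (C * L) ≤ n := by nlinarith
  have hCLn2 : 18 * (C * L) * (C * L) ≤ n := by nlinarith
  set p := α * L / n with hp
  set q := β * L / n with hq
  have hnp : n * p = α * L := by rw [hp]; field_simp
  have hnq : n * q = β * L := by rw [hq]; field_simp
  have hp0 : 0 < p := by positivity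
  have hq0 : 0 < q := by positivity
  have hqp : q ≤ p := by rw [hp, hq]; gcongr
  have hpt : p ≤ C * L / n := by rw [hp]; gcongr
  have ht : C * L / n ≤ 1 / 2 := by rw [div_le_iff₀ hn0]; linarith
  have hp1 : p ≤ 1 := by linarith
  have hq1 : q ≤ 1 := by linarith
  set l1 := n * p * Real.exp p with hl1
  set l2 := n * q * Real.exp q with hl2
  have hl10 : 0 < l1 := by positivity
  have hl20 : 0 < l2 := by positivity
  set s1 := √l1 with hs1
  set s2 := √l2 with hs2
  have hs10 : 0 < s1 := Real.sqrt_pos.mpr hl10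
  have hs20 : 0 < s2 := Real.sqrt_pos.mpr hl20
  have hs1q : s1 ^ 2 = l1 := Real.sq_sqrt hl10.le
  have hs2q : s2 ^ 2 = l2 := Real.sq_sqrt hl20.le
  set x := s1 * s2 with hx
  set r := s2 / s1 with hr
  set x0 := √(α * β) * L with hx0
  have hsab : 0 < √(α * β) := Real.sqrt_pos.mpr (by positivity)
  -- bounds on x
  have hxe : x = x0 * Real.exp ((p + q) / 2) := by
    rw [hx, hs1, hs2, ← Real.sqrt_mul hl10.le]
    rw [Real.sqrt_eq_iff_mul_self_eq (by positivity) (by positivity)]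
    have h1 : Real.exp ((p + q) / 2) * Real.exp ((p + q) / 2) = Real.exp p * Real.exp q := by
      rw [← Real.exp_add, ← Real.exp_add]; congr 1; ring
    have h2 : √(α * β) * √(α * β) = α * β := Real.mul_self_sqrt (by positivity)
    symm
    calc _ = (√(α * β) * √(α * β)) * L * L * (Real.exp ((p + q) / 2) * Real.exp ((p + q) / 2)) := by
          rw [hx0]; ring
      _ = _ := by rw [h1, h2, hl1, hl2, hnp, hnq]; ring
  have hsC : C⁻¹ ≤ √(α * β) := by
    apply Real.le_sqrt_of_sq_le
    rw [sq]
    have : C⁻¹ ≤ α := hβ.trans hβα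
    gcongr
  have hsC2 : √(α * β) ≤ C := by
    rw [Real.sqrt_le_left hC0.le, sq]
    have : β ≤ C := hβα.trans hα
    gcongr
  have hx0L : L / C ≤ x0 := by
    rw [hx0, div_eq_mul_inv, mul_comm]; gcongr
  have hx0x : x0 ≤ x := by
    rw [hxe]
    have he1 : 1 ≤ Real.exp ((p + q) / 2) := Real.one_le_exp (by positivity)
    have hx00 : 0 < x0 := by positivity
    exact le_mul_of_one_le_right hx00.le he1
  have hLC : 1 ≤ L / C := by rw [le_div_iff₀ hC0]; linarith
  have hx1 : 1 ≤ x := by linarith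
  have hxx0 : x ≤ x0 + 1 := by
    set t := C * L / n with htdef
    have ht0 : 0 < t := by positivity
    have h1 : Real.exp ((p + q) / 2) ≤ 1 + 2 * t := by
      have h2 : Real.exp ((p + q) / 2) ≤ Real.exp t := Real.exp_le_exp.mpr (by linarith)
      have h8 := exp_le_lin t ht ht0
      linarith
    have h9 : x0 * t ≤ 1 / 2 := by
      have : x0 ≤ C * L := by rw [hx0]; gcongr
      calc x0 * t ≤ (C * L) * t := by gcongr
        _ = (C * L) * (C * L) / n := by rw [htdef]; ring
        _ ≤ 1 / 2 := by rw [div_le_iff₀ hn0]; linarith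
    rw [hxe]
    have hx00 : 0 < x0 := by positivity
    have h10 : x0 * Real.exp ((p + q) / 2) ≤ x0 * (1 + 2 * t) := by gcongr
    linarith
  -- bound on r
  have hr0 : 0 < r := by positivity
  have hrr : r ≤ √β / √α := by
    rw [hr, hs1, hs2, ← Real.sqrt_div hl20.le, ← Real.sqrt_div hβ0.le]
    apply Real.sqrt_le_sqrt
    rw [div_le_div_iff₀ hl10 hα0, hl1, hl2, hnp, hnq]
    have : Real.exp q ≤ Real.exp p := Real.exp_le_exp.mpr hqp
    calc _ = (α * β * L) * Real.exp q := by ring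
      _ ≤ (α * β * L) * Real.exp p := by gcongr
      _ = _ := by ring
  have hsa : 0 < √α := Real.sqrt_pos.mpr hα0
  have hsb : 0 < √β := Real.sqrt_pos.mpr hβ0
  have hr1 : 1 / (2 * C) ≤ 1 - r := by
    have h8 := ratio_bound C α β hC hβ0 hβα hα hD
    linarith
  have hr2 : r < 1 := by
    have : 0 < 1 / (2 * C) := by positivity
    linarith
  have hr3 : 1 / (1 - r) ≤ 2 * C := by
    rw [div_le_iff₀ (by linarith)]
    rw [div_le_iff₀ (by positivity)] at hr1
    linarith
  -- main
  set u : ℕ → ℝ := fun k => x ^ k / (k.factorial : ℝ) with hu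
  have main : prGE n p n q ≤ (Real.exp (-(α * L)) * Real.exp (-(β * L))) *
      ∑ j ∈ Finset.range (n + 1), ∑ k ∈ Finset.range (n + 1),
        (if j ≤ k then u j * u k * r ^ (k - j) else 0) := by
    unfold prGE prGEshift
    rw [Finset.mul_sum]
    apply Finset.sum_le_sum; intro j hj
    rw [Finset.mul_sum]
    apply Finset.sum_le_sum; intro k hk
    simp only [sub_zero, Nat.cast_le]
    have hj' : j ≤ n := by simp at hj; omega
    have hk' : k ≤ n := by simp at hk; omega
    split_ifs with hjk
    · have b1 := binom_upper n j hj' p hp0.le hp1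
      have b2 := binom_upper n k hk' q hq0.le hq1
      rw [← hl1, hnp] at b1
      rw [← hl2, hnq] at b2
      have b3 := binomProb_nonneg' n k q hq0.le hq1
      calc _ ≤ (l1 ^ j / (j.factorial : ℝ) * Real.exp (-(α * L))) *
              (l2 ^ k / (k.factorial : ℝ) * Real.exp (-(β * L))) := by gcongr
        _ = _ := by
          obtain ⟨d, rfl⟩ := Nat.exists_eq_add_of_le hjk
          rw [← hs1q, ← hs2q, hu, hx, hr]
          simp only [Nat.add_sub_cancel_left]
          have hid := pow_ident s1 s2 hs10.ne' j d
          calc _ = ((s1 ^ 2) ^ j * (s2 ^ 2) ^ (j + d)) / ((j.factorial : ℝ) * ((j + d).factorial : ℝ)) *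
                (Real.exp (-(α * L)) * Real.exp (-(β * L))) := by ring
            _ = _ := by rw [hid]; ring
    · simp
  refine main.trans ?_
  have hdd := double_sum u r hr0.le hr2 (n + 1)
  have hbb := bessel_upper x hx1 n
  have hsum0 : 0 ≤ ∑ k ∈ Finset.range (n + 1), u k ^ 2 := Finset.sum_nonneg (fun _ _ => sq_nonneg _)
  have hsx : √L / √C ≤ √x := by
    rw [← Real.sqrt_div hL0.le]; exact Real.sqrt_le_sqrt (by linarith)
  have hsL : 0 < √L := Real.sqrt_pos.mpr hL0
  have hsCp : 0 < √C := Real.sqrt_pos.mpr hC0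
  have hex : Real.exp x ≤ Real.exp (x0 + 1) := Real.exp_le_exp.mpr hxx0
  calc _ ≤ (Real.exp (-(α * L)) * Real.exp (-(β * L))) *
        (2 * C * (Real.exp (x0 + 1) * (Real.exp (x0 + 1) / (√L / √C)))) := by
        gcongr
        refine hdd.trans ?_
        calc _ ≤ 2 * C * (Real.exp x * (Real.exp x / √x)) := by gcongr
          _ ≤ _ := by gcongr
    _ = (2 * C * √C) * (Real.exp (-(α * L)) * Real.exp (-(β * L)) * Real.exp (x0 + 1) * Real.exp (x0 + 1)) / √L := by
        field_simp
    _ = (2 * C * √C) * (Real.exp 2 * Real.exp (-(α + β - 2 * √(α * β)) * L)) / √L := by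
        rw [← Real.exp_add, ← Real.exp_add, ← Real.exp_add, ← Real.exp_add]
        congr 3
        rw [hx0]; ring
    _ = _ := by ring

set_option maxHeartbeats 1000000 in
theorem prGE_lower (C α β L : ℝ) (n : ℕ) (hC : 1 ≤ C) (hβ : C⁻¹ ≤ β) (hβC : β ≤ C)
    (hα' : C⁻¹ ≤ α) (hα : α ≤ C) (hL : C ≤ L) (hLn : 18 * C ^ 2 * L ^ 2 ≤ n) :
    (1 / (160 * √C)) * (Real.exp (-(α + β - 2 * √(α * β)) * L) / √L) ≤
      prGE n (α * L / n) n (β * L / n) := by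
  have hC0 : 0 < C := by linarith
  have hL0 : 0 < L := by linarith
  have hβ0 : 0 < β := lt_of_lt_of_le (by positivity) hβ
  have hα0 : 0 < α := lt_of_lt_of_le (by positivity) hα'
  have hCL : 1 ≤ C * L := by nlinarith
  have hn0 : (0 : ℝ) < n := lt_of_lt_of_le (by positivity) hLn
  have hn00 : 0 < n := by exact_mod_cast hn0
  have hCLn : 18 * (C * L) ≤ n := by nlinarith
  have hCLn2 : 18 * (C * L) ^ 2 ≤ n := by nlinarith
  have aux : ∀ γ : ℝ, 0 < γ → γ ≤ C → 0 ≤ γ * L / n ∧ γ * L / n ≤ 1 ∧ 2 * n * (γ * L / n) ^ 2 ≤ 1 := by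
    intro γ h0 h1
    have h2 : γ * L ≤ C * L := by gcongr
    have h3 : 0 < γ * L := by positivity
    refine ⟨by positivity, ?_, ?_⟩
    · rw [div_le_one hn0]; linarith
    · have : 2 * n * (γ * L / n) ^ 2 = 2 * (γ * L) ^ 2 / n := by field_simp
      rw [this, div_le_one hn0]
      nlinarith
  obtain ⟨hp0, hp1, hp2⟩ := aux α hα0 hα
  obtain ⟨hq0, hq1, hq2⟩ := aux β hβ0 hβC
  set p := α * L / n with hp
  set q := β * L / n with hq
  have hnp : n * p = α * L := by rw [hp]; field_simp
  have hnq : n * q = β * L := by rw [hq]; field_simp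
  set x := √(α * β) * L with hx0
  have hsq : √(α * β) ^ 2 = α * β := Real.sq_sqrt (by positivity)
  have hsC : C⁻¹ ≤ √(α * β) := by
    apply Real.le_sqrt_of_sq_le
    rw [sq]
    gcongr
  have hsC2 : √(α * β) ≤ C := by
    rw [Real.sqrt_le_left hC0.le, sq]
    gcongr
  have hx0L : L / C ≤ x := by
    rw [hx0, div_eq_mul_inv, mul_comm]; gcongr
  have hLC : 1 ≤ L / C := by rw [le_div_iff₀ hC0]; linarith
  have hx1 : 1 ≤ x := by linarith
  have hxC : x ≤ C * L := by rw [hx0]; gcongr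
  have hbl := bessel_lower x hx1
  set W := Finset.Icc ⌈x - 2 * √x⌉₊ ⌊x + 2 * √x⌋₊ with hW
  have hk : ∀ k ∈ W, (k : ℝ) ≤ 3 * (C * L) := by
    intro k hk
    have h1 := (Finset.mem_Icc.mp hk).2
    rw [Nat.le_floor_iff (by positivity)] at h1
    have h2 : √x ≤ x := by
      rw [Real.sqrt_le_left (by linarith)]; nlinarith
    linarith
  have hWs : W ⊆ Finset.range (n + 1) := by
    intro k hk'
    have := hk k hk'
    have h2 : (k : ℝ) ≤ n := by linarith
    have h3 : k ≤ n := by exact_mod_cast h2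
    simp; omega
  have main : ∑ k ∈ W, (1 / 16) * (Real.exp (-(α * L)) * Real.exp (-(β * L))) * (x ^ k / (k.factorial : ℝ)) ^ 2
      ≤ prGE n p n q := by
    unfold prGE prGEshift
    refine le_trans ?_ (Finset.sum_le_sum_of_subset_of_nonneg hWs ?_)
    · apply Finset.sum_le_sum
      intro k hkW
      have hkk : 2 * (k : ℝ) ^ 2 ≤ n := by
        have := hk k hkW
        have h0 : (0 : ℝ) ≤ k := by positivity
        nlinarith
      refine le_trans ?_ (Finset.single_le_sum (a := k) ?_ (hWs hkW))
      · simp only [sub_zero, le_refl, if_true]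
        have b1 := binom_lower n k hn00 hkk p hp0 hp1 hp2
        have b2 := binom_lower n k hn00 hkk q hq0 hq1 hq2
        rw [hnp] at b1
        rw [hnq] at b2
        have b3 := binomProb_nonneg' n k p hp0 hp1
        calc _ = (1 / 4 * ((α * L) ^ k / (k.factorial : ℝ) * Real.exp (-(α * L)))) *
              (1 / 4 * ((β * L) ^ k / (k.factorial : ℝ) * Real.exp (-(β * L)))) := by
              have : (x ^ k) ^ 2 = (α * L) ^ k * (β * L) ^ k := by
                rw [← pow_mul, mul_comm k 2, pow_mul, ← mul_pow]
                congr 1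
                rw [hx0, mul_pow, hsq]; ring
              rw [div_pow, this]; ring
          _ ≤ _ := by gcongr
      · intro i _
        have b3 := binomProb_nonneg' n k p hp0 hp1
        have b4 := binomProb_nonneg' n i q hq0 hq1
        split_ifs <;> positivity
    · intro j _ _
      apply Finset.sum_nonneg
      intro i _
      have b3 := binomProb_nonneg' n j p hp0 hp1
      have b4 := binomProb_nonneg' n i q hq0 hq1
      split_ifs <;> positivity
  refine le_trans ?_ main
  rw [← Finset.mul_sum]
  have hsL : 0 < √L := Real.sqrt_pos.mpr hL0
  have hsCp : 0 < √C := Real.sqrt_pos.mpr hC0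
  have hsx : √x ≤ √C * √L := by
    rw [← Real.sqrt_mul hC0.le]; exact Real.sqrt_le_sqrt hxC
  have hsx0 : 0 < √x := Real.sqrt_pos.mpr (by linarith)
  calc _ = (1 / 160) * (Real.exp (-(α + β - 2 * √(α * β)) * L)) / (√C * √L) := by field_simp
    _ = (1 / 160) * (Real.exp (-(α * L)) * Real.exp (-(β * L)) * Real.exp x * Real.exp x) / (√C * √L) := by
        rw [← Real.exp_add, ← Real.exp_add, ← Real.exp_add]
        congr 3
        rw [hx0]; ring
    _ ≤ (1 / 160) * (Real.exp (-(α * L)) * Real.exp (-(β * L)) * Real.exp x * Real.exp x) / √x := by gcongr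
    _ = 1 / 16 * (Real.exp (-(α * L)) * Real.exp (-(β * L))) * (1 / 10 * (Real.exp x * (Real.exp x / √x))) := by ring
    _ ≤ _ := by gcongr

theorem exp_form (n : ℕ) (hn : 0 < n) (hL : 0 < Real.log n) (D : ℝ) :
    (n : ℝ) * (Real.exp (-D * Real.log n) / √(Real.log n)) =
      Real.exp (-((D - 1) * Real.log n + (1 / 2) * Real.log (Real.log n))) := by
  have hn0 : (0 : ℝ) < n := by exact_mod_cast hn
  have h1 : √(Real.log n) = Real.exp ((1 / 2) * Real.log (Real.log n)) := by
    rw [Real.sqrt_eq_rpow, Real.rpow_def_of_pos hL, mul_comm]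
  rw [h1, ← Real.exp_sub]
  nth_rewrite 1 [← Real.exp_log hn0]
  rw [← Real.exp_add]
  congr 1; ring

theorem Pn_eq (n : ℕ) (a b L : ℝ) (hL : 0 ≤ L) :
    ∃ α β : ℝ, β ≤ α ∧ ((α = a ∧ β = b) ∨ (α = b ∧ β = a)) ∧
      Pn n (a * L / n) (b * L / n) = prGE n (α * L / n) n (β * L / n) := by
  unfold Pn Pmn
  rcases le_total a b with h | h
  · have h' : a * L / n ≤ b * L / n := by gcongr
    exact ⟨b, a, h, Or.inr ⟨rfl, rfl⟩, by rw [max_eq_right h', min_eq_left h']⟩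
  · have h' : b * L / n ≤ a * L / n := by gcongr
    exact ⟨a, b, h, Or.inl ⟨rfl, rfl⟩, by rw [max_eq_left h', min_eq_right h']⟩

theorem sparse_strong_consistency_characterization
    (C : ℝ) (hC : 0 < C) (a b : ℕ → ℝ)
    (hab : ∀ᶠ n : ℕ in atTop, C⁻¹ ≤ a n ∧ a n ≤ C ∧ C⁻¹ ≤ b n ∧ b n ≤ C) :
    Tendsto (fun n : ℕ =>
        (n : ℝ) * Pn n (a n * Real.log n / n) (b n * Real.log n / n)) atTop (nhds 0) ↔
    Tendsto (fun n : ℕ =>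
        (a n + b n - 2 * Real.sqrt (a n * b n) - 1) * Real.log n
          + (1 / 2) * Real.log (Real.log n)) atTop atTop := by
  have hC1 : 1 ≤ C := by
    obtain ⟨n, h1, h2, -⟩ := hab.exists
    have h3 : C⁻¹ ≤ C := h1.trans h2
    rw [inv_le_iff_one_le_mul₀ hC] at h3
    nlinarith
  have hlogT : Tendsto (fun n : ℕ => Real.log n) atTop atTop :=
    Real.tendsto_log_atTop.comp tendsto_natCast_atTop_atTop
  have hL : ∀ᶠ n : ℕ in atTop, C ≤ Real.log n := hlogT.eventually_ge_atTop C
  have hLn : ∀ᶠ n : ℕ in atTop, 18 * C ^ 2 * Real.log n ^ 2 ≤ n := by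
    have h1 : (fun x : ℝ => Real.log x ^ 2) =o[atTop] (fun x : ℝ => x) := Real.isLittleO_pow_log_id_atTop
    have h2 := h1.bound (c := 1 / (18 * C ^ 2)) (by positivity)
    have h3 := (tendsto_natCast_atTop_atTop (R := ℝ)).eventually h2
    filter_upwards [h3] with n hn
    rw [Real.norm_of_nonneg (by positivity), Real.norm_of_nonneg (by positivity)] at hn
    rw [one_div, ← div_eq_inv_mul, le_div_iff₀ (by positivity)] at hn
    linarith
  have hn0 : ∀ᶠ n : ℕ in atTop, 0 < n := eventually_gt_atTop 0
  set T : ℕ → ℝ := fun n => (a n + b n - 2 * Real.sqrt (a n * b n) - 1) * Real.log n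
          + (1 / 2) * Real.log (Real.log n) with hT
  have lower : ∀ᶠ n : ℕ in atTop, (1 / (160 * √C)) * Real.exp (-(T n)) ≤
      (n : ℝ) * Pn n (a n * Real.log n / n) (b n * Real.log n / n) := by
    filter_upwards [hab, hL, hLn, hn0] with n ⟨h1, h2, h3, h4⟩ hL hLn hn0
    have hl0 : 0 < Real.log n := by linarith
    obtain ⟨α, β, hle, hor, heq⟩ := Pn_eq n (a n) (b n) (Real.log n) hl0.le
    rw [heq, hT]
    simp only
    rw [← exp_form n hn0 hl0 (a n + b n - 2 * √(a n * b n))]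
    have key : (1 / (160 * √C)) * (Real.exp (-(a n + b n - 2 * √(a n * b n)) * Real.log n) / √(Real.log n)) ≤
      prGE n (α * Real.log n / n) n (β * Real.log n / n) := by
      rcases hor with ⟨rfl, rfl⟩ | ⟨rfl, rfl⟩
      · exact prGE_lower C (a n) (b n) _ n hC1 h3 h4 h1 h2 hL hLn
      · have := prGE_lower C (b n) (a n) _ n hC1 h1 h2 h3 h4 hL hLn
        rwa [add_comm (b n) (a n), mul_comm (b n) (a n)] at this
    calc _ = (n : ℝ) * ((1 / (160 * √C)) * (Real.exp (-(a n + b n - 2 * √(a n * b n)) * Real.log n) / √(Real.log n))) := by ring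
      _ ≤ _ := by gcongr
  have upper : ∀ᶠ n : ℕ in atTop, 0 ≤ T n →
      (n : ℝ) * Pn n (a n * Real.log n / n) (b n * Real.log n / n) ≤
        (2 * C * √C * Real.exp 2) * Real.exp (-(T n)) := by
    filter_upwards [hab, hL, hLn, hn0] with n ⟨h1, h2, h3, h4⟩ hL hLn hn0 hT0
    have hl0 : 0 < Real.log n := by linarith
    have hD : 1 / 2 ≤ a n + b n - 2 * √(a n * b n) := by
      by_contra hcon
      push Not at hcon
      have h5 : Real.log (Real.log n) ≤ Real.log n - 1 := Real.log_le_sub_one_of_pos hl0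
      simp only [hT] at hT0
      nlinarith
    obtain ⟨α, β, hle, hor, heq⟩ := Pn_eq n (a n) (b n) (Real.log n) hl0.le
    rw [heq, hT]
    simp only
    rw [← exp_form n hn0 hl0 (a n + b n - 2 * √(a n * b n))]
    have key : prGE n (α * Real.log n / n) n (β * Real.log n / n) ≤ (2 * C * √C * Real.exp 2) *
        (Real.exp (-(a n + b n - 2 * √(a n * b n)) * Real.log n) / √(Real.log n)) := by
      rcases hor with ⟨rfl, rfl⟩ | ⟨rfl, rfl⟩
      · exact prGE_upper C (a n) (b n) _ n hC1 h3 hle h2 hL hLn hD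
      · have := prGE_upper C (b n) (a n) _ n hC1 h1 hle h4 hL hLn
          (by rwa [add_comm (b n) (a n), mul_comm (b n) (a n)])
        rwa [add_comm (b n) (a n), mul_comm (b n) (a n)] at this
    calc _ ≤ (n : ℝ) * ((2 * C * √C * Real.exp 2) * (Real.exp (-(a n + b n - 2 * √(a n * b n)) * Real.log n) / √(Real.log n))) := by gcongr
      _ = _ := by ring
  have hsC : 0 < √C := Real.sqrt_pos.mpr hC
  constructor
  · intro h
    have h1 : Tendsto (fun n => Real.exp (-(T n))) atTop (nhds 0) := by
      have h2 := h.const_mul (160 * √C)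
      rw [mul_zero] at h2
      refine squeeze_zero' (Eventually.of_forall fun n => (Real.exp_pos _).le) ?_ h2
      filter_upwards [lower] with n hn
      calc Real.exp (-(T n)) = 160 * √C * ((1 / (160 * √C)) * Real.exp (-(T n))) := by field_simp
        _ ≤ _ := by gcongr
    rw [Real.tendsto_exp_comp_nhds_zero] at h1
    exact tendsto_neg_atBot_iff.mp h1
  · intro h
    have h1 : Tendsto (fun n => (2 * C * √C * Real.exp 2) * Real.exp (-(T n))) atTop (nhds 0) := by
      have h2 : Tendsto (fun n => Real.exp (-(T n))) atTop (nhds 0) := by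
        rw [Real.tendsto_exp_comp_nhds_zero]
        exact tendsto_neg_atBot_iff.mpr h
      simpa using h2.const_mul (2 * C * √C * Real.exp 2)
    refine squeeze_zero' ?_ ?_ h1
    · filter_upwards [lower] with n hn
      exact le_trans (by positivity) hn
    · filter_upwards [upper, h.eventually_ge_atTop 0] with n hn h0
      exact hn h0
end

section
/- Let C > 0 and ε > 0 be constants and let a_n, b_n be sequences with C^{-1} ≤ b_n, b_n + ε ≤ a_n ≤ C, and a_n + b_n ≥ 1 for all sufficiently large n. Set p_n = a_n (log n)/n and q_n = b_n (log n)/n, and let X ~ Binomial(n, p_n) and Y ~ Binomial(n, q_n) be independent. Then there is a constant K ≥ 1 such that for all sufficiently large n, K^{-1} · n^{2√(a_n b_n) − (a_n + b_n)} (log n)^{-1/2} ≤ Pr(Y ≥ X) ≤ K · n^{2√(a_n b_n) − (a_n + b_n)} (log n)^{-1/2}. -/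
open Real Filter

/-! Upper bound ingredients. -/

lemma aux_central (j : ℕ) : ((2 * j).choose j : ℝ) ^ 2 * (2 * j + 1) ≤ 16 ^ j := by
  induction j with
  | zero => simp
  | succ j ih =>
    have h := Nat.succ_mul_centralBinom_succ j
    simp only [Nat.centralBinom] at h
    have h' : ((j : ℝ) + 1) * ((2 * (j + 1)).choose (j + 1) : ℝ)
        = 2 * (2 * j + 1) * ((2 * j).choose j : ℝ) := by exact_mod_cast h
    set A := ((2 * (j + 1)).choose (j + 1) : ℝ)
    set B := ((2 * j).choose j : ℝ)
    have hj : (0 : ℝ) ≤ j := Nat.cast_nonneg j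
    have hA : A = 2 * (2 * j + 1) * B / (j + 1) := by
      field_simp; linarith
    have : A ^ 2 * (2 * ((j + 1 : ℕ) : ℝ) + 1)
        = (B ^ 2 * (2 * j + 1)) * (4 * (2 * j + 1) * (2 * j + 3) / (j + 1) ^ 2) := by
      rw [hA]; push_cast; field_simp; ring
    rw [this, pow_succ]
    have h2 : 4 * (2 * (j : ℝ) + 1) * (2 * j + 3) / (j + 1) ^ 2 ≤ 16 := by
      rw [div_le_iff₀ (by positivity)]; nlinarith
    have h3 : 0 ≤ 4 * (2 * (j : ℝ) + 1) * (2 * j + 3) / (j + 1) ^ 2 := by positivity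
    have h4 : (0 : ℝ) ≤ 16 ^ j := by positivity
    exact mul_le_mul ih h2 h3 h4

/-- termwise bound of the Bessel series -/
lemma aux_bessel_term (x : ℝ) (hx : 0 < x) (j : ℕ) :
    (x ^ j / j.factorial) ^ 2 ≤
      1 / 2 * ((Real.sqrt (2 * x))⁻¹ * ((2 * x) ^ (2 * j) / (2 * j).factorial)
        + (Real.sqrt (2 * x))⁻¹ * ((2 * x) ^ (2 * j + 1) / (2 * j + 1).factorial)) := by
  set T := Real.sqrt (2 * x) with hT
  have hTpos : 0 < T := by positivity
  have hT2 : T ^ 2 = 2 * x := Real.sq_sqrt (by positivity)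
  have hc : ((2 * j).factorial : ℝ) = ((2 * j).choose j : ℝ) * j.factorial * j.factorial := by
    have := Nat.choose_mul_factorial_mul_factorial (show j ≤ 2 * j by omega)
    rw [show 2 * j - j = j by omega] at this
    exact_mod_cast this.symm
  have hf1 : (0 : ℝ) < j.factorial := by positivity
  have hf2 : (0 : ℝ) < (2 * j).factorial := by positivity
  have h1 : (x ^ j / j.factorial) ^ 2 = ((2 * j).choose j : ℝ) * (x ^ (2 * j) / (2 * j).factorial) := by
    have hcp : (0 : ℝ) < ((2 * j).choose j : ℝ) := by
      exact_mod_cast Nat.choose_pos (by omega)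
    rw [hc]; field_simp; ring
  have hcen := aux_central j
  set B := ((2 * j).choose j : ℝ)
  have hB : 0 ≤ B := Nat.cast_nonneg _
  set m : ℝ := 2 * (j : ℝ) + 1 with hm
  have hmpos : 0 < m := by positivity
  have h2 : B ≤ 4 ^ j * (1 / 2 * (T⁻¹ + T / m)) := by
    have h4 : ((16 : ℝ)) ^ j = (4 ^ j) ^ 2 := by rw [← pow_mul, mul_comm, pow_mul]; norm_num
    rw [h4] at hcen
    have hsq : B ^ 2 ≤ (4 ^ j * (1 / 2 * (T⁻¹ + T / m))) ^ 2 := by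
      have h5 : 1 / m ≤ (1 / 2 * (T⁻¹ + T / m)) ^ 2 := by
        have e : (1 / 2 * (T⁻¹ + T / m)) ^ 2 - 1 / m = (1 / 2 * (T⁻¹ - T / m)) ^ 2 := by
          field_simp; ring
        nlinarith [sq_nonneg (1 / 2 * (T⁻¹ - T / m))]
      calc B ^ 2 ≤ (4 ^ j) ^ 2 * (1 / m) := by
            rw [mul_one_div, le_div_iff₀ hmpos]; exact hcen
        _ ≤ _ := by rw [mul_pow]; gcongr
    exact le_of_sq_le_sq hsq (by positivity)
  rw [h1]
  calc B * (x ^ (2 * j) / (2 * j).factorial)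
      ≤ (4 ^ j * (1 / 2 * (T⁻¹ + T / m))) * (x ^ (2 * j) / (2 * j).factorial) := by gcongr
    _ = _ := by
      have h6 : (2 * x) ^ (2 * j) = 4 ^ j * x ^ (2 * j) := by
        rw [mul_pow, pow_mul 2 2 j]; norm_num
      have h7 : ((2 * j + 1).factorial : ℝ) = m * (2 * j).factorial := by
        rw [Nat.factorial_succ]; push_cast; ring
      rw [pow_succ, h6, h7, ← hT2]
      field_simp

lemma aux_bessel (x : ℝ) (hx : 0 < x) (N : ℕ) :
    ∑ j ∈ Finset.range N, (x ^ j / j.factorial) ^ 2 ≤ Real.exp (2 * x) / Real.sqrt (2 * x) := by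
  have hsum : ∀ M : ℕ, ∑ j ∈ Finset.range M,
      ((2 * x) ^ (2 * j) / ((2 * j).factorial : ℝ) + (2 * x) ^ (2 * j + 1) / ((2 * j + 1).factorial : ℝ))
      = ∑ i ∈ Finset.range (2 * M), (2 * x) ^ i / (i.factorial : ℝ) := by
    intro M
    induction M with
    | zero => simp
    | succ M ih =>
      rw [Finset.sum_range_succ, ih, show 2 * (M + 1) = 2 * M + 1 + 1 by ring,
        Finset.sum_range_succ, Finset.sum_range_succ]; ring
  have hT : 0 < Real.sqrt (2 * x) := by positivity
  have he := Real.sum_le_exp_of_nonneg (show 0 ≤ 2 * x by positivity) (2 * N)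
  calc ∑ j ∈ Finset.range N, (x ^ j / j.factorial) ^ 2
      ≤ ∑ j ∈ Finset.range N, 1 / 2 * (Real.sqrt (2 * x))⁻¹ *
        ((2 * x) ^ (2 * j) / ((2 * j).factorial : ℝ) + (2 * x) ^ (2 * j + 1) / ((2 * j + 1).factorial : ℝ)) := by
        refine Finset.sum_le_sum fun j _ => ?_
        refine (aux_bessel_term x hx j).trans (le_of_eq ?_)
        ring
    _ = 1 / 2 * (Real.sqrt (2 * x))⁻¹ * ∑ i ∈ Finset.range (2 * N), (2 * x) ^ i / (i.factorial : ℝ) := by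
        rw [← Finset.mul_sum, hsum]
    _ ≤ 1 / 2 * (Real.sqrt (2 * x))⁻¹ * Real.exp (2 * x) := by gcongr
    _ ≤ _ := by
        rw [div_eq_inv_mul (Real.exp (2 * x))]
        have : 0 < (Real.sqrt (2 * x))⁻¹ * Real.exp (2 * x) := by positivity
        linarith

lemma aux_geom (ρ : ℝ) (h0 : 0 ≤ ρ) (h1 : ρ < 1) (s : Finset ℕ) :
    ∑ i ∈ s, ρ ^ i ≤ (1 - ρ)⁻¹ := by
  rw [← tsum_geometric_of_lt_one h0 h1]
  exact (summable_geometric_of_lt_one h0 h1).sum_le_tsum s (fun i _ => by positivity)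

lemma aux_upper (lam mu ρ : ℝ) (hl : 0 < lam) (hm : 0 < mu) (h0 : 0 ≤ ρ) (h1 : ρ < 1)
    (hr : mu ≤ ρ ^ 2 * lam) (N : ℕ) :
    ∑ j ∈ Finset.range N, ∑ k ∈ Finset.range N,
      (if j ≤ k then (lam ^ j / j.factorial) * (mu ^ k / k.factorial) else 0)
    ≤ (1 - ρ)⁻¹ * (Real.exp (2 * Real.sqrt (lam * mu)) / Real.sqrt (2 * Real.sqrt (lam * mu))) := by
  set s := Real.sqrt lam with hs
  set t := Real.sqrt mu with ht
  have hs0 : 0 < s := Real.sqrt_pos.2 hl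
  have ht0 : 0 < t := Real.sqrt_pos.2 hm
  have hs2 : lam = s ^ 2 := (Real.sq_sqrt hl.le).symm
  have ht2 : mu = t ^ 2 := (Real.sq_sqrt hm.le).symm
  have hx : Real.sqrt (lam * mu) = s * t := Real.sqrt_mul hl.le mu
  rw [hx]
  set x := s * t with hxd
  have hx0 : 0 < x := by positivity
  have hts : t ≤ ρ * s := by
    refine le_of_sq_le_sq ?_ (by positivity)
    rw [mul_pow, ← hs2, ← ht2]; exact hr
  set g : ℕ → ℕ → ℝ := fun j k => if j ≤ k then ρ ^ (k - j) else 0 with hg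
  set u : ℕ → ℝ := fun j => x ^ j / j.factorial with hu
  have hu0 : ∀ j, 0 ≤ u j := fun j => by positivity
  have hg0 : ∀ j k, 0 ≤ g j k := fun j k => by simp only [hg]; split_ifs <;> positivity
  have hterm : ∀ j k, (if j ≤ k then (lam ^ j / j.factorial) * (mu ^ k / k.factorial) else 0)
      ≤ g j k * (1 / 2 * u j ^ 2) + g j k * (1 / 2 * u k ^ 2) := by
    intro j k
    by_cases hjk : j ≤ k
    · obtain ⟨d, rfl⟩ := Nat.exists_eq_add_of_le hjk
      simp only [hg, hjk, if_true, Nat.add_sub_cancel_left]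
      have h2 : lam ^ j * mu ^ (j + d) ≤ ρ ^ d * (x ^ j * x ^ (j + d)) := by
        have : t ^ d ≤ ρ ^ d * s ^ d := by rw [← mul_pow]; gcongr
        calc lam ^ j * mu ^ (j + d) = (s ^ (2 * j) * t ^ (2 * j) * t ^ d) * t ^ d := by
              rw [hs2, ht2]; ring
          _ ≤ (s ^ (2 * j) * t ^ (2 * j) * t ^ d) * (ρ ^ d * s ^ d) := by gcongr
          _ = _ := by rw [hxd]; ring
      have h3 : (lam ^ j / (j.factorial : ℝ)) * (mu ^ (j + d) / ((j + d).factorial : ℝ))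
          ≤ ρ ^ d * (u j * u (j + d)) := by
        simp only [hu]
        rw [div_mul_div_comm, div_mul_div_comm, ← mul_div_assoc]
        gcongr
      have h4 : u j * u (j + d) ≤ 1 / 2 * u j ^ 2 + 1 / 2 * u (j + d) ^ 2 := by
        nlinarith [sq_nonneg (u j - u (j + d))]
      have h5 : 0 ≤ ρ ^ d := by positivity
      nlinarith [mul_le_mul_of_nonneg_left h4 h5]
    · simp [hg, hjk]
  have hgk : ∀ j, ∑ k ∈ Finset.range N, g j k ≤ (1 - ρ)⁻¹ := by
    intro j
    simp only [hg]
    rw [← Finset.sum_filter]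
    refine le_trans (le_of_eq ?_) (aux_geom ρ h0 h1 (((Finset.range N).filter (fun k => j ≤ k)).image (fun k => k - j)))
    rw [Finset.sum_image]
    intro a ha b hb hab
    simp at ha hb hab
    omega
  have hgj : ∀ k, ∑ j ∈ Finset.range N, g j k ≤ (1 - ρ)⁻¹ := by
    intro k
    simp only [hg]
    rw [← Finset.sum_filter]
    refine le_trans (le_of_eq ?_) (aux_geom ρ h0 h1 (((Finset.range N).filter (fun j => j ≤ k)).image (fun j => k - j)))
    rw [Finset.sum_image]
    intro a ha b hb hab
    simp at ha hb hab
    omega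
  have hb := aux_bessel x hx0 N
  have hrp : 0 < (1 - ρ)⁻¹ := inv_pos.2 (by linarith)
  calc _ ≤ ∑ j ∈ Finset.range N, ∑ k ∈ Finset.range N,
        (g j k * (1 / 2 * u j ^ 2) + g j k * (1 / 2 * u k ^ 2)) :=
        Finset.sum_le_sum fun j _ => Finset.sum_le_sum fun k _ => hterm j k
    _ = ∑ j ∈ Finset.range N, (∑ k ∈ Finset.range N, g j k) * (1 / 2 * u j ^ 2)
        + ∑ k ∈ Finset.range N, (∑ j ∈ Finset.range N, g j k) * (1 / 2 * u k ^ 2) := by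
        simp only [Finset.sum_add_distrib]
        congr 1
        · simp only [Finset.sum_mul]
        · rw [Finset.sum_comm]; simp only [Finset.sum_mul]
    _ ≤ ∑ j ∈ Finset.range N, (1 - ρ)⁻¹ * (1 / 2 * u j ^ 2)
        + ∑ k ∈ Finset.range N, (1 - ρ)⁻¹ * (1 / 2 * u k ^ 2) := by
        gcongr with j _ k _
        · exact hgk j
        · exact hgj k
    _ = (1 - ρ)⁻¹ * ∑ j ∈ Finset.range N, u j ^ 2 := by
        rw [← Finset.mul_sum, ← Finset.mul_sum]; ring
    _ ≤ _ := by gcongr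

/-! Lower bound ingredients. -/

lemma aux_hasSum_exp (x : ℝ) : HasSum (fun n : ℕ => x ^ n / (n.factorial : ℝ)) (Real.exp x) := by
  have := NormedSpace.expSeries_div_hasSum_exp x
  rwa [← Real.exp_eq_exp_ℝ] at this

lemma aux_hasSum_one (x : ℝ) :
    HasSum (fun n : ℕ => (n : ℝ) * (x ^ n / (n.factorial : ℝ))) (x * Real.exp x) := by
  rw [← hasSum_nat_add_iff' 1]
  simp only [Finset.sum_range_one, Nat.cast_zero, zero_mul, sub_zero]
  refine ((aux_hasSum_exp x).mul_left x).congr_fun ?_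
  intro n
  rw [Nat.factorial_succ]; push_cast; field_simp; ring

lemma aux_hasSum_two (x : ℝ) :
    HasSum (fun n : ℕ => (n : ℝ) ^ 2 * (x ^ n / (n.factorial : ℝ))) ((x ^ 2 + x) * Real.exp x) := by
  rw [← hasSum_nat_add_iff' 1]
  have h := ((aux_hasSum_one x).mul_left x).add ((aux_hasSum_exp x).mul_left x)
  simp only [Finset.sum_range_one, Nat.cast_zero]
  rw [show (x ^ 2 + x) * Real.exp x - 0 ^ 2 * (x ^ 0 / ((Nat.factorial 0 : ℕ) : ℝ))
    = x * (x * Real.exp x) + x * Real.exp x by ring]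
  refine h.congr_fun ?_
  intro n
  rw [Nat.factorial_succ]; push_cast; field_simp; ring

lemma aux_hasSum_var (x : ℝ) :
    HasSum (fun n : ℕ => ((n : ℝ) - x) ^ 2 * (x ^ n / (n.factorial : ℝ))) (x * Real.exp x) := by
  have h := ((aux_hasSum_two x).sub ((aux_hasSum_one x).mul_left (2 * x))).add
    ((aux_hasSum_exp x).mul_left (x ^ 2))
  rw [show (x ^ 2 + x) * Real.exp x - 2 * x * (x * Real.exp x) + x ^ 2 * Real.exp x
    = x * Real.exp x by ring] at h
  refine h.congr_fun ?_
  intro n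
  ring

lemma aux_lower (x : ℝ) (hx : 4 ≤ x) :
    ∃ S : Finset ℕ, (∀ j ∈ S, (j : ℝ) ≤ 3 * x) ∧
      9 / 80 * (Real.exp (2 * x) / Real.sqrt x) ≤ ∑ j ∈ S, (x ^ j / (j.factorial : ℝ)) ^ 2 := by
  set r := Real.sqrt x with hr
  have hr2 : r ^ 2 = x := Real.sq_sqrt (by linarith)
  have hr0 : 2 ≤ r := by rw [hr]; exact Real.le_sqrt_of_sq_le (by linarith)
  set S := Finset.Icc ⌈x - 2 * r⌉₊ ⌊x + 2 * r⌋₊ with hS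
  have hmem : ∀ j : ℕ, j ∈ S ↔ x - 2 * r ≤ j ∧ (j : ℝ) ≤ x + 2 * r := by
    intro j
    rw [hS, Finset.mem_Icc, Nat.ceil_le, Nat.le_floor_iff (by nlinarith)]
  refine ⟨S, ?_, ?_⟩
  · intro j hj
    have := ((hmem j).1 hj).2
    nlinarith
  set u : ℕ → ℝ := fun j => x ^ j / (j.factorial : ℝ) with hu
  have hu0 : ∀ j, 0 ≤ u j := fun j => by
    have : 0 ≤ x := by linarith
    positivity
  have hcard : (S.card : ℝ) ≤ 5 * r := by
    rw [hS, Nat.card_Icc]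
    have h1 : ((⌊x + 2 * r⌋₊ + 1 - ⌈x - 2 * r⌉₊ : ℕ) : ℝ) ≤ max ((⌊x + 2 * r⌋₊ : ℝ) + 1 - ⌈x - 2 * r⌉₊) 0 := by
      rcases le_total ⌈x - 2 * r⌉₊ (⌊x + 2 * r⌋₊ + 1) with h | h
      · rw [Nat.cast_sub h]; push_cast; exact le_max_left _ _
      · rw [Nat.sub_eq_zero_of_le h]; simp
    have h2 := Nat.floor_le (show 0 ≤ x + 2 * r by nlinarith)
    have h3 := Nat.le_ceil (x - 2 * r)
    refine h1.trans (max_le ?_ ?_) <;> linarith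
  have hmain : 3 / 4 * Real.exp x ≤ ∑ j ∈ S, u j := by
    -- compare with the series of `u j - (j-x)^2 u j / (4x)`
    have hs := (aux_hasSum_exp x).sub ((aux_hasSum_var x).mul_left (1 / (4 * x)))
    have hval : Real.exp x - 1 / (4 * x) * (x * Real.exp x) = 3 / 4 * Real.exp x := by
      have : x ≠ 0 := by linarith
      field_simp; ring
    rw [hval] at hs
    have hs2 : HasSum (fun j => if j ∈ S then u j else 0) (∑ j ∈ S, u j) := by
      have := hasSum_sum_of_ne_finset_zero (L := SummationFilter.unconditional ℕ)
        (f := fun j => if j ∈ S then u j else 0) (s := S)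
        (fun j hj => by simp [hj])
      rwa [Finset.sum_congr rfl (fun j hj => if_pos hj)] at this
    refine hasSum_le ?_ hs hs2
    intro j
    change u j - 1 / (4 * x) * (((j : ℝ) - x) ^ 2 * u j) ≤ if j ∈ S then u j else 0
    have hxp : 0 < 4 * x := by linarith
    split_ifs with hj
    · have : 0 ≤ 1 / (4 * x) * (((j : ℝ) - x) ^ 2 * u j) := by
        have := hu0 j
        positivity
      linarith
    · have h1 : 1 ≤ 1 / (4 * x) * ((j : ℝ) - x) ^ 2 := by
        rw [one_div, inv_mul_eq_div, le_div_iff₀ hxp]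
        rw [hmem] at hj
        by_cases h : x - 2 * r ≤ j
        · have : x + 2 * r < j := by
            by_contra h'; exact hj ⟨h, not_lt.1 h'⟩
          nlinarith
        · push Not at h
          nlinarith
      nlinarith [mul_le_mul_of_nonneg_right h1 (hu0 j)]
  have hcs := sq_sum_le_card_mul_sum_sq (s := S) (f := u)
  have hq : 0 ≤ ∑ j ∈ S, u j ^ 2 := Finset.sum_nonneg fun j _ => sq_nonneg _
  have he : Real.exp (2 * x) = Real.exp x ^ 2 := by rw [← Real.exp_nat_mul]; norm_num
  have h9 : 9 / 16 * Real.exp (2 * x) ≤ 5 * r * ∑ j ∈ S, u j ^ 2 := by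
    calc 9 / 16 * Real.exp (2 * x) = (3 / 4 * Real.exp x) ^ 2 := by rw [he]; ring
      _ ≤ (∑ j ∈ S, u j) ^ 2 := by gcongr
      _ ≤ _ := hcs
      _ ≤ _ := by gcongr
  rw [← mul_div_assoc, div_le_iff₀ (by linarith)]
  linarith

/-! Binomial versus Poisson. -/

lemma aux_binom_le (n : ℕ) (lam : ℝ) (hn : 0 < n) (h0 : 0 ≤ lam) (h1 : lam ≤ n) (k : ℕ) (hk : k ≤ n) :
    binomProb n (lam / n) k ≤
      Real.exp (-lam) * ((lam * Real.exp (lam / n)) ^ k / (k.factorial : ℝ)) := by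
  have hn' : (0 : ℝ) < n := by exact_mod_cast hn
  have hp0 : 0 ≤ lam / n := by positivity
  have hp1 : 0 ≤ 1 - lam / n := by rw [sub_nonneg, div_le_one hn']; exact h1
  unfold binomProb
  have hch : (n.choose k : ℝ) ≤ (n : ℝ) ^ k / k.factorial := Nat.choose_le_pow_div k n
  have he : (1 - lam / n) ^ (n - k) ≤ Real.exp (-lam) * Real.exp (lam / n) ^ k := by
    calc (1 - lam / n) ^ (n - k) ≤ (Real.exp (-(lam / n))) ^ (n - k) := by
          gcongr; exact Real.one_sub_le_exp_neg _
      _ = _ := by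
          rw [← Real.exp_nat_mul, ← Real.exp_nat_mul, ← Real.exp_add, Nat.cast_sub hk]
          congr 1; field_simp; ring
  calc (n.choose k : ℝ) * (lam / n) ^ k * (1 - lam / n) ^ (n - k)
      ≤ ((n : ℝ) ^ k / k.factorial) * (lam / n) ^ k * (Real.exp (-lam) * Real.exp (lam / n) ^ k) := by
        gcongr
    _ = _ := by
        rw [mul_pow, div_pow]; field_simp

lemma aux_binom_nonneg (n : ℕ) (p : ℝ) (h0 : 0 ≤ p) (h1 : p ≤ 1) (k : ℕ) : 0 ≤ binomProb n p k := by
  unfold binomProb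
  have : 0 ≤ 1 - p := by linarith
  positivity

lemma aux_exp_le (p : ℝ) (h0 : 0 ≤ p) (h1 : p ≤ 1 / 2) : Real.exp (-(p + 2 * p ^ 2)) ≤ 1 - p := by
  have h := Real.add_one_le_exp (p + 2 * p ^ 2)
  rw [Real.exp_neg]
  refine inv_le_of_inv_le₀ (by linarith) (le_trans ?_ h)
  rw [inv_le_iff_one_le_mul₀ (by linarith)]
  nlinarith [sq_nonneg p, mul_nonneg (sq_nonneg p) (show 0 ≤ 1 / 2 - p by linarith), mul_nonneg h0 (show 0 ≤ 1 / 2 - p by linarith)]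

lemma aux_le_binom (n : ℕ) (lam : ℝ) (hn : 0 < n) (h0 : 0 ≤ lam) (h1 : lam ≤ n / 2)
    (h2 : 2 * lam ^ 2 ≤ n) (k : ℕ) (hk : (k : ℝ) ^ 2 ≤ n / 2) :
    (2 * Real.exp 1)⁻¹ * (Real.exp (-lam) * (lam ^ k / (k.factorial : ℝ))) ≤
      binomProb n (lam / n) k := by
  have hn' : (0 : ℝ) < n := by exact_mod_cast hn
  have hp0 : 0 ≤ lam / n := by positivity
  have hp1 : lam / n ≤ 1 / 2 := by rw [div_le_iff₀ hn']; linarith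
  have hkn : k ≤ n := by
    have : (k : ℝ) ≤ n := by
      rcases Nat.eq_zero_or_pos k with h | h
      · rw [h]; simp
      · have : (1 : ℝ) ≤ k := by exact_mod_cast h
        nlinarith
    exact_mod_cast this
  have hkn' : (k : ℝ) ≤ n := by exact_mod_cast hkn
  unfold binomProb
  have hch : ((n : ℝ) - k) ^ k / k.factorial ≤ (n.choose k : ℝ) := by
    have h := Nat.pow_le_choose (α := ℝ) k n
    refine le_trans ?_ h
    gcongr
    · rw [Nat.cast_sub (by omega)]; push_cast; linarith
  have hb : (1 / 2 : ℝ) ≤ (1 - k / n) ^ k := by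
    have h := one_add_mul_le_pow (a := -((k : ℝ) / n)) (by
      have : (k : ℝ) / n ≤ 1 := by rw [div_le_one hn']; exact hkn'
      linarith) k
    rw [← sub_eq_add_neg] at h
    refine le_trans ?_ h
    have : (k : ℝ) * (k / n) ≤ 1 / 2 := by
      rw [← mul_div_assoc, div_le_iff₀ hn']; nlinarith
    linarith
  have hch2 : 1 / 2 * ((n : ℝ) ^ k / k.factorial) ≤ (n.choose k : ℝ) := by
    refine le_trans ?_ hch
    have : ((n : ℝ) - k) ^ k = (1 - k / n) ^ k * n ^ k := by
      rw [← mul_pow]; congr 1; field_simp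
    rw [this, mul_div_assoc]
    gcongr
  have he : (Real.exp 1)⁻¹ * Real.exp (-lam) ≤ (1 - lam / n) ^ (n - k) := by
    calc (Real.exp 1)⁻¹ * Real.exp (-lam) = Real.exp (-1 + -lam) := by
          rw [Real.exp_add, Real.exp_neg 1]
      _ ≤ Real.exp (n * (-(lam / n + 2 * (lam / n) ^ 2))) := by
          apply Real.exp_le_exp.2
          have : (n : ℝ) * (-(lam / n + 2 * (lam / n) ^ 2)) = -lam - 2 * lam ^ 2 / n := by
            field_simp; ring
          rw [this]
          have : 2 * lam ^ 2 / n ≤ 1 := by rw [div_le_one hn']; exact h2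
          linarith
      _ = (Real.exp (-(lam / n + 2 * (lam / n) ^ 2))) ^ n := by rw [Real.exp_nat_mul]
      _ ≤ (1 - lam / n) ^ n := by
          gcongr; exact aux_exp_le _ hp0 hp1
      _ ≤ _ := pow_le_pow_of_le_one (by linarith) (by linarith) (Nat.sub_le n k)
  calc _ = (1 / 2 * ((n : ℝ) ^ k / k.factorial)) * (lam / n) ^ k * ((Real.exp 1)⁻¹ * Real.exp (-lam)) := by
        rw [div_pow]; field_simp
    _ ≤ _ := by gcongr

set_option maxHeartbeats 1000000 in
lemma aux_core_upper (C ε a b L : ℝ) (n : ℕ) (hC : 0 < C) (hε : 0 < ε)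
    (h1 : C⁻¹ ≤ b) (h2 : b + ε ≤ a) (h3 : a ≤ C) (hL : 1 ≤ L)
    (hn1 : 2 * C * L ≤ n) (hn2 : 18 * (C * L) ^ 2 ≤ n) :
    prGE n (a * L / n) n (b * L / n) ≤
      (Real.exp 1 * (1 - Real.sqrt (1 - ε / C))⁻¹ * Real.sqrt C) *
        (Real.exp (L * (2 * Real.sqrt (a * b) - (a + b))) / Real.sqrt L) := by
  have hCi : 0 < C⁻¹ := inv_pos.2 hC
  have hb : 0 < b := by linarith
  have ha : 0 < a := by linarith
  have hn : (0 : ℝ) < n := lt_of_lt_of_le (by positivity) hn1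
  have hn0 : 0 < n := by exact_mod_cast hn
  set lam := a * L with hlam
  set mu := b * L with hmu
  have hlam0 : 0 < lam := by positivity
  have hmu0 : 0 < mu := by positivity
  have hlamC : lam ≤ C * L := by rw [hlam]; gcongr
  have hmul : mu ≤ lam := by rw [hlam, hmu]; gcongr; linarith
  set ρ := Real.sqrt (1 - ε / C) with hρ
  have hεC : ε / C ≤ 1 := by rw [div_le_one hC]; linarith
  have hρ0 : 0 ≤ ρ := Real.sqrt_nonneg _
  have hρ2 : ρ ^ 2 = 1 - ε / C := Real.sq_sqrt (by linarith)
  have hεC0 : 0 < ε / C := by positivity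
  have hρ1 : ρ < 1 := by nlinarith
  set lam' := lam * Real.exp (lam / n) with hlam'
  set mu' := mu * Real.exp (mu / n) with hmu'
  have hr : mu' ≤ ρ ^ 2 * lam' := by
    have e1 : mu ≤ ρ ^ 2 * lam := by
      rw [hρ2, hlam, hmu, ← mul_assoc]
      gcongr
      have : ε / C * a ≤ ε := by
        rw [div_mul_eq_mul_div, div_le_iff₀ hC]; gcongr
      nlinarith
    have e2 : Real.exp (mu / n) ≤ Real.exp (lam / n) := by gcongr
    rw [hlam', hmu', ← mul_assoc]
    gcongr
  have hup := aux_upper lam' mu' ρ (by positivity) (by positivity) hρ0 hρ1 hr (n + 1)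
  set x := L * Real.sqrt (a * b) with hx
  have hx0 : 0 < x := by positivity
  have hx2 : x ^ 2 = lam * mu := by
    rw [hx, mul_pow, Real.sq_sqrt (by positivity)]; ring
  have hxlam : x ≤ C * L := by
    refine le_trans ?_ hlamC
    refine le_of_sq_le_sq ?_ hlam0.le
    rw [hx2]; nlinarith
  have hxlow : C⁻¹ * L ≤ x := by
    have : mu ≤ x := by
      refine le_of_sq_le_sq ?_ hx0.le
      rw [hx2]; nlinarith
    refine le_trans ?_ this
    rw [hmu]; gcongr
  have hprod : lam' * mu' = x ^ 2 * Real.exp ((lam + mu) / n) := by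
    rw [hx2, hlam', hmu', add_div, Real.exp_add]; ring
  have hpq0 : 0 ≤ (lam + mu) / n := by positivity
  have hpq1 : (lam + mu) / n ≤ 1 := by rw [div_le_one hn]; linarith
  have hxpq : x * ((lam + mu) / n) ≤ 1 / 2 := by
    rw [← mul_div_assoc, div_le_iff₀ hn]
    have : x * (lam + mu) ≤ (C * L) * (2 * (C * L)) := by
      gcongr; linarith
    nlinarith [sq_nonneg (C * L)]
  have hexp : Real.exp ((lam + mu) / n) ≤ 1 + 2 * ((lam + mu) / n) := by
    have := Real.abs_exp_sub_one_le (x := (lam + mu) / n) (by rw [abs_of_nonneg hpq0]; exact hpq1)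
    rw [abs_of_nonneg hpq0] at this
    have := (abs_le.1 this).2
    linarith
  set x' := Real.sqrt (lam' * mu') with hx'
  have hx'up : x' ≤ x + 1 / 2 := by
    rw [hx']
    apply Real.sqrt_le_iff.2
    refine ⟨by linarith, ?_⟩
    rw [hprod]
    nlinarith [mul_le_mul_of_nonneg_left hexp (sq_nonneg x), mul_le_mul_of_nonneg_left hxpq hx0.le]
  have hx'low : x ≤ x' := by
    apply Real.le_sqrt_of_sq_le
    rw [hprod]
    exact le_mul_of_one_le_right (sq_nonneg x) (Real.one_le_exp hpq0)
  have hmain : prGE n (lam / n) n (mu / n) ≤ Real.exp (-lam) * Real.exp (-mu) *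
      ∑ j ∈ Finset.range (n + 1), ∑ k ∈ Finset.range (n + 1),
      (if j ≤ k then (lam' ^ j / j.factorial) * (mu' ^ k / k.factorial) else 0) := by
    unfold prGE prGEshift
    simp only [Finset.mul_sum]
    refine Finset.sum_le_sum fun j hj => Finset.sum_le_sum fun k hk => ?_
    rw [Finset.mem_range] at hj hk
    simp only [sub_zero, Nat.cast_le]
    split_ifs
    · have e1 := aux_binom_le n lam hn0 hlam0.le (by linarith) j (by omega)
      have e2 := aux_binom_le n mu hn0 hmu0.le (by linarith) k (by omega)
      have e3 := aux_binom_nonneg n (mu / n) (by positivity) (by rw [div_le_one hn]; linarith) k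
      refine (mul_le_mul e1 e2 e3 (by positivity)).trans (le_of_eq ?_)
      ring
    · simp
  refine hmain.trans ?_
  have hfin : Real.exp (2 * x') / Real.sqrt (2 * x') ≤
      Real.exp 1 * Real.sqrt C * (Real.exp (2 * x) / Real.sqrt L) := by
    have e1 : Real.exp (2 * x') ≤ Real.exp 1 * Real.exp (2 * x) := by
      rw [← Real.exp_add]; gcongr; linarith
    have e2 : Real.sqrt L ≤ Real.sqrt C * Real.sqrt (2 * x') := by
      rw [← Real.sqrt_mul hC.le]
      apply Real.sqrt_le_sqrt
      have : L ≤ C * x := by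
        calc L = C * (C⁻¹ * L) := by field_simp
          _ ≤ _ := by gcongr
      nlinarith
    have hs : 0 < Real.sqrt (2 * x') := Real.sqrt_pos.2 (by linarith)
    have hsL : 0 < Real.sqrt L := Real.sqrt_pos.2 (by linarith)
    rw [div_le_iff₀ hs]
    refine e1.trans ?_
    have : Real.exp 1 * Real.sqrt C * (Real.exp (2 * x) / Real.sqrt L) * Real.sqrt (2 * x')
        = Real.exp 1 * Real.exp (2 * x) * (Real.sqrt C * Real.sqrt (2 * x') / Real.sqrt L) := by ring
    rw [this]
    refine le_mul_of_one_le_right (by positivity) ?_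
    rw [le_div_iff₀ hsL]; linarith
  have hrp : 0 < (1 - ρ)⁻¹ := inv_pos.2 (by linarith)
  calc _ ≤ Real.exp (-lam) * Real.exp (-mu) * ((1 - ρ)⁻¹ *
        (Real.exp 1 * Real.sqrt C * (Real.exp (2 * x) / Real.sqrt L))) := by
        gcongr
        exact hup.trans (by gcongr)
    _ = _ := by
        have : Real.exp (L * (2 * Real.sqrt (a * b) - (a + b)))
            = Real.exp (-lam) * Real.exp (-mu) * Real.exp (2 * x) := by
          rw [← Real.exp_add, ← Real.exp_add]; congr 1; rw [hx, hlam, hmu]; ring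
        rw [this]; ring

lemma aux_core_lower (C ε a b L : ℝ) (n : ℕ) (hC : 0 < C) (hε : 0 < ε)
    (h1 : C⁻¹ ≤ b) (h2 : b + ε ≤ a) (h3 : a ≤ C) (hL : 1 ≤ L) (hL4 : 4 * C ≤ L)
    (hn1 : 2 * C * L ≤ n) (hn2 : 18 * (C * L) ^ 2 ≤ n) :
    (4 * Real.exp 1 ^ 2 * (80 / 9) * Real.sqrt C)⁻¹ *
        (Real.exp (L * (2 * Real.sqrt (a * b) - (a + b))) / Real.sqrt L) ≤
    prGE n (a * L / n) n (b * L / n) := by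
  have hCi : 0 < C⁻¹ := inv_pos.2 hC
  have hb : 0 < b := by linarith
  have ha : 0 < a := by linarith
  have hn : (0 : ℝ) < n := lt_of_lt_of_le (by positivity) hn1
  have hn0 : 0 < n := by exact_mod_cast hn
  set lam := a * L with hlam
  set mu := b * L with hmu
  have hlam0 : 0 < lam := by positivity
  have hmu0 : 0 < mu := by positivity
  have hlamC : lam ≤ C * L := by rw [hlam]; gcongr
  have hmul : mu ≤ lam := by rw [hlam, hmu]; gcongr; linarith
  set x := L * Real.sqrt (a * b) with hx
  have hx0 : 0 < x := by positivity
  have hx2 : x ^ 2 = lam * mu := by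
    rw [hx, mul_pow, Real.sq_sqrt (by positivity)]; ring
  have hxlam : x ≤ C * L := by
    refine le_trans ?_ hlamC
    refine le_of_sq_le_sq ?_ hlam0.le
    rw [hx2]; nlinarith
  have hxlow : C⁻¹ * L ≤ x := by
    have : mu ≤ x := by
      refine le_of_sq_le_sq ?_ hx0.le
      rw [hx2]; nlinarith
    refine le_trans ?_ this
    rw [hmu]; gcongr
  have hx4 : 4 ≤ x := by
    calc 4 = C⁻¹ * (4 * C) := by field_simp
      _ ≤ C⁻¹ * L := by gcongr
      _ ≤ x := hxlow
  obtain ⟨S, hS3, hS⟩ := aux_lower x hx4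
  have hk2 : ∀ k ∈ S, (k : ℝ) ^ 2 ≤ n / 2 := by
    intro k hk
    have e1 : (k : ℝ) ≤ 3 * (C * L) := (hS3 k hk).trans (by linarith)
    have e2 : (k : ℝ) ^ 2 ≤ (3 * (C * L)) ^ 2 := by gcongr
    nlinarith
  have hSn : S ⊆ Finset.range (n + 1) := by
    intro k hk
    rw [Finset.mem_range, Nat.lt_succ_iff]
    have e1 := hk2 k hk
    have : (k : ℝ) ≤ n := by
      rcases Nat.eq_zero_or_pos k with h | h
      · rw [h]; simp
      · have : (1 : ℝ) ≤ k := by exact_mod_cast h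
        nlinarith
    exact_mod_cast this
  have hP : ∀ k, 0 ≤ binomProb n (lam / n) k := fun k =>
    aux_binom_nonneg n _ (by positivity) (by rw [div_le_one hn]; linarith) k
  have hQ : ∀ k, 0 ≤ binomProb n (mu / n) k := fun k =>
    aux_binom_nonneg n _ (by positivity) (by rw [div_le_one hn]; linarith) k
  have hl2 : 2 * lam ^ 2 ≤ n := by
    have : lam ^ 2 ≤ (C * L) ^ 2 := by gcongr
    nlinarith [sq_nonneg (C * L)]
  have hm2 : 2 * mu ^ 2 ≤ n := by
    have : mu ^ 2 ≤ lam ^ 2 := by gcongr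
    linarith
  have hdiag : ∑ j ∈ S, binomProb n (lam / n) j * binomProb n (mu / n) j ≤
      prGE n (lam / n) n (mu / n) := by
    unfold prGE prGEshift
    simp only [sub_zero, Nat.cast_le]
    have hnn : ∀ j k : ℕ, 0 ≤ if j ≤ k then binomProb n (lam / n) j * binomProb n (mu / n) k else 0 := by
      intro j k
      split_ifs
      · exact mul_nonneg (hP j) (hQ k)
      · exact le_rfl
    calc _ ≤ ∑ j ∈ S, ∑ k ∈ Finset.range (n + 1),
          (if j ≤ k then binomProb n (lam / n) j * binomProb n (mu / n) k else 0) := by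
          refine Finset.sum_le_sum fun j hj => ?_
          have := Finset.single_le_sum (f := fun k => if j ≤ k then binomProb n (lam / n) j * binomProb n (mu / n) k else 0)
            (fun k _ => hnn j k) (hSn hj)
          simpa using this
      _ ≤ _ := Finset.sum_le_sum_of_subset_of_nonneg hSn
          (fun j _ _ => Finset.sum_nonneg fun k _ => hnn j k)
  refine le_trans ?_ hdiag
  have hterm : ∀ j ∈ S, ((2 * Real.exp 1)⁻¹) ^ 2 * (Real.exp (-lam) * Real.exp (-mu)) *
      (x ^ j / (j.factorial : ℝ)) ^ 2 ≤ binomProb n (lam / n) j * binomProb n (mu / n) j := by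
    intro j hj
    have e1 := aux_le_binom n lam hn0 hlam0.le (by linarith) hl2 j (hk2 j hj)
    have e2 := aux_le_binom n mu hn0 hmu0.le (by linarith) hm2 j (hk2 j hj)
    refine le_trans (le_of_eq ?_) (mul_le_mul e1 e2 (by positivity) (hP j))
    have : (x ^ j) ^ 2 = lam ^ j * mu ^ j := by rw [← mul_pow, ← hx2, ← pow_mul, ← pow_mul, mul_comm]
    rw [div_pow, this]; ring
  refine le_trans ?_ (Finset.sum_le_sum hterm)
  rw [← Finset.mul_sum]
  refine le_trans ?_ (mul_le_mul_of_nonneg_left hS (by positivity))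
  have hE : Real.exp (L * (2 * Real.sqrt (a * b) - (a + b)))
      = Real.exp (-lam) * Real.exp (-mu) * Real.exp (2 * x) := by
    rw [← Real.exp_add, ← Real.exp_add]; congr 1; rw [hx, hlam, hmu]; ring
  rw [hE]
  have hsx : Real.sqrt x ≤ Real.sqrt C * Real.sqrt L := by
    rw [← Real.sqrt_mul hC.le]; exact Real.sqrt_le_sqrt hxlam
  have hsx0 : 0 < Real.sqrt x := Real.sqrt_pos.2 hx0
  calc _ = ((2 * Real.exp 1)⁻¹) ^ 2 * (Real.exp (-lam) * Real.exp (-mu)) *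
        (9 / 80 * (Real.exp (2 * x) / (Real.sqrt C * Real.sqrt L))) := by
        rw [inv_pow]; field_simp; norm_num
    _ ≤ _ := by gcongr

theorem sparse_binomial_probability_asymptotics
    (C ε : ℝ) (hC : 0 < C) (hε : 0 < ε) (a b : ℕ → ℝ)
    (hab : ∀ᶠ n : ℕ in atTop,
      C⁻¹ ≤ b n ∧ b n + ε ≤ a n ∧ a n ≤ C ∧ 1 ≤ a n + b n) :
    ∃ K : ℝ, 1 ≤ K ∧ ∀ᶠ n : ℕ in atTop,
      K⁻¹ * (n : ℝ) ^ (2 * Real.sqrt (a n * b n) - (a n + b n)) *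
          (Real.log n) ^ (-(1 / 2) : ℝ)
        ≤ prGE n (a n * Real.log n / n) n (b n * Real.log n / n) ∧
      prGE n (a n * Real.log n / n) n (b n * Real.log n / n)
        ≤ K * (n : ℝ) ^ (2 * Real.sqrt (a n * b n) - (a n + b n)) *
            (Real.log n) ^ (-(1 / 2) : ℝ) := by
  set K1 := Real.exp 1 * (1 - Real.sqrt (1 - ε / C))⁻¹ * Real.sqrt C with hK1
  set K2 := 4 * Real.exp 1 ^ 2 * (80 / 9) * Real.sqrt C with hK2
  have hK20 : 0 < K2 := by positivity
  have hlog : Tendsto (fun n : ℕ => Real.log (n : ℝ)) atTop atTop :=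
    Real.tendsto_log_atTop.comp tendsto_natCast_atTop_atTop
  have hlo : ∀ᶠ n : ℕ in atTop, (18 * C ^ 2 + 2 * C) * Real.log (n : ℝ) ^ 2 ≤ n := by
    have hM : 0 < 18 * C ^ 2 + 2 * C := by positivity
    have h := (Real.isLittleO_pow_log_id_atTop (n := 2)).bound (inv_pos.2 hM)
    filter_upwards [tendsto_natCast_atTop_atTop.eventually h] with n hn
    simp only [id, Real.norm_eq_abs, abs_pow, sq_abs, Nat.abs_cast] at hn
    rwa [inv_mul_eq_div, le_div_iff₀ hM, mul_comm] at hn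
  refine ⟨1 + |K1| + K2, by have := abs_nonneg K1; linarith, ?_⟩
  filter_upwards [hab, hlo, hlog.eventually_ge_atTop 1, hlog.eventually_ge_atTop (4 * C),
    eventually_gt_atTop 0] with n hn hn2 hL1 hL4 hn0
  obtain ⟨h1, h2, h3, -⟩ := hn
  set L := Real.log (n : ℝ) with hL
  have hnpos : (0 : ℝ) < n := by exact_mod_cast hn0
  have hLL : L ≤ L ^ 2 := by nlinarith
  have hcl : C * L ≤ C * L ^ 2 := by gcongr
  have hsq : 0 ≤ C ^ 2 * L ^ 2 := by positivity
  have hc1 : 2 * C * L ≤ n := by nlinarith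
  have hc2 : 18 * (C * L) ^ 2 ≤ n := by nlinarith
  have hup := aux_core_upper C ε (a n) (b n) L n hC hε h1 h2 h3 hL1 hc1 hc2
  have hlow := aux_core_lower C ε (a n) (b n) L n hC hε h1 h2 h3 hL1 hL4 hc1 hc2
  rw [Real.rpow_def_of_pos hnpos, ← hL, Real.rpow_neg (by linarith), ← Real.sqrt_eq_rpow,
    mul_assoc, mul_assoc, ← div_eq_mul_inv]
  set E := Real.exp (L * (2 * Real.sqrt (a n * b n) - (a n + b n))) / Real.sqrt L with hE
  have hE0 : 0 ≤ E := by positivity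
  constructor
  · refine le_trans ?_ hlow
    gcongr
    have := abs_nonneg K1
    linarith
  · refine hup.trans ?_
    gcongr
    have := le_abs_self K1
    linarith
end

section
/- There is a universal constant C > 0 such that for all positive integers m, n ≥ 2 and all p, q ∈ [0, 2/3]: (1 − C m^{-1/3}) · P(m−1, n, p, q) − 2 m^{-2} ≤ P(m, n, p, q) ≤ (1 + C n^{-1/3}) · P(m, n−1, p, q) + 2 n^{-2}. -/
open Real Filter

lemma bp_nonneg (m : ℕ) {p : ℝ} (h0 : 0 ≤ p) (h1 : p ≤ 1) (k : ℕ) : 0 ≤ binomProb m p k := by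
  have : 0 ≤ 1 - p := by linarith
  unfold binomProb; positivity

lemma bp_zero_of_lt {m k : ℕ} (p : ℝ) (h : m < k) : binomProb m p k = 0 := by
  simp [binomProb, Nat.choose_eq_zero_of_lt h]

lemma bp_sum (m : ℕ) (p : ℝ) : ∑ k ∈ Finset.range (m + 1), binomProb m p k = 1 := by
  have h := add_pow p (1 - p) m
  rw [add_sub_cancel, one_pow] at h
  rw [h]
  apply Finset.sum_congr rfl
  intro k _
  unfold binomProb; ring

lemma bp_succ_zero (m : ℕ) (p : ℝ) : binomProb (m + 1) p 0 = (1 - p) * binomProb m p 0 := by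
  simp [binomProb, pow_succ]; ring

lemma bp_succ (m : ℕ) (p : ℝ) (k : ℕ) :
    binomProb (m + 1) p (k + 1) = p * binomProb m p k + (1 - p) * binomProb m p (k + 1) := by
  unfold binomProb
  rw [Nat.choose_succ_succ]
  rcases lt_or_ge k m with h | h
  · obtain ⟨d, rfl⟩ := Nat.exists_eq_add_of_lt h
    have e1 : k + d + 1 + 1 - (k + 1) = d + 1 := by omega
    have e2 : k + d + 1 - k = d + 1 := by omega
    have e3 : k + d + 1 - (k + 1) = d := by omega
    rw [e1, e2, e3]; push_cast; ring
  · have e1 : m + 1 - (k + 1) = 0 := by omega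
    have e2 : m - k = 0 := by omega
    rw [e1, e2, Nat.choose_eq_zero_of_lt (show m < k + 1 by omega)]; push_cast; ring

/-- cumulative distribution -/
noncomputable def cdfB (m : ℕ) (p : ℝ) (k : ℕ) : ℝ := ∑ i ∈ Finset.range (k + 1), binomProb m p i

lemma cdfB_step (m : ℕ) (p : ℝ) (k : ℕ) :
    cdfB (m + 1) p k = cdfB m p k - p * binomProb m p k := by
  induction k with
  | zero => simp [cdfB, bp_succ_zero]; ring
  | succ k ih =>
    unfold cdfB at *
    rw [Finset.sum_range_succ, ih, Finset.sum_range_succ _ (k + 1), bp_succ]; ring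

lemma cdfB_ge (m : ℕ) (p : ℝ) {k : ℕ} (h : m ≤ k) : cdfB m p k = 1 := by
  rw [← bp_sum m p]
  unfold cdfB
  symm
  apply Finset.sum_subset
  · intro x; simp; omega
  · intro x _ hx
    apply bp_zero_of_lt
    simp at hx; omega

lemma cdfB_mono (m : ℕ) {p : ℝ} (h0 : 0 ≤ p) (h1 : p ≤ 1) {k l : ℕ} (h : k ≤ l) :
    cdfB m p k ≤ cdfB m p l := by
  unfold cdfB
  apply Finset.sum_le_sum_of_subset_of_nonneg
  · intro x; simp; omega
  · intro i _ _; exact bp_nonneg m h0 h1 i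

lemma cdfB_le_one (m : ℕ) {p : ℝ} (h0 : 0 ≤ p) (h1 : p ≤ 1) (k : ℕ) : cdfB m p k ≤ 1 := by
  rw [← cdfB_ge m p (le_max_left m k)]
  exact cdfB_mono m h0 h1 (le_max_right _ _)

lemma cdfB_nonneg (m : ℕ) {p : ℝ} (h0 : 0 ≤ p) (h1 : p ≤ 1) (k : ℕ) : 0 ≤ cdfB m p k :=
  Finset.sum_nonneg fun i _ => bp_nonneg m h0 h1 i

lemma bp_le_cdfB (m : ℕ) {p : ℝ} (h0 : 0 ≤ p) (h1 : p ≤ 1) (k : ℕ) :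
    binomProb m p k ≤ cdfB m p k :=
  Finset.single_le_sum (f := fun i => binomProb m p i) (fun i _ => bp_nonneg m h0 h1 i)
    (Finset.mem_range.2 (Nat.lt_succ_self k))

lemma cdfB_succ (m : ℕ) (p : ℝ) (k : ℕ) :
    cdfB m p (k + 1) = cdfB m p k + binomProb m p (k + 1) := by
  unfold cdfB; rw [Finset.sum_range_succ]

lemma inner_F (m : ℕ) (p : ℝ) (k : ℕ) :
    ∑ j ∈ Finset.range (m + 1), (if j ≤ k then binomProb m p j else 0) = cdfB m p k := by
  rw [← Finset.sum_filter]
  unfold cdfB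
  apply Finset.sum_subset
  · intro x hx; rw [Finset.mem_filter] at hx; exact Finset.mem_range.2 (Nat.lt_succ_of_le hx.2)
  · intro x hx hx'
    apply bp_zero_of_lt
    simp at hx hx'; omega

lemma prGE_eq_F (m : ℕ) (p : ℝ) (n : ℕ) (q : ℝ) :
    prGE m p n q = ∑ k ∈ Finset.range (n + 1), binomProb n q k * cdfB m p k := by
  unfold prGE prGEshift
  rw [Finset.sum_comm]
  apply Finset.sum_congr rfl
  intro k _
  rw [← inner_F, Finset.mul_sum]
  apply Finset.sum_congr rfl
  intro j _
  simp only [sub_zero, Nat.cast_le]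
  split_ifs <;> ring

lemma inner_G (n : ℕ) (q : ℝ) (j : ℕ) :
    ∑ k ∈ Finset.range (n + 1), (if j + 1 ≤ k then binomProb n q k else 0) = 1 - cdfB n q j := by
  rw [← bp_sum n q, ← inner_F, ← Finset.sum_sub_distrib]
  apply Finset.sum_congr rfl
  intro k _
  split_ifs <;> first | omega | ring

lemma prGE_eq_G (m : ℕ) (p : ℝ) (n : ℕ) (q : ℝ) :
    prGE m p n q = binomProb m p 0 +
      ∑ j ∈ Finset.range m, binomProb m p (j + 1) * (1 - cdfB n q j) := by
  unfold prGE prGEshift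
  rw [Finset.sum_range_succ', add_comm]
  congr 1
  · simp [← Finset.mul_sum, bp_sum]
  · apply Finset.sum_congr rfl
    intro j _
    rw [← inner_G, Finset.mul_sum]
    apply Finset.sum_congr rfl
    intro k _
    simp only [sub_zero, Nat.cast_le]
    split_ifs <;> ring

lemma bp_ratio (N : ℕ) (q : ℝ) (k : ℕ) (hk : k ≤ N) :
    ((k : ℝ) + 1) * (1 - q) * binomProb N q (k + 1) = ((N : ℝ) - k) * q * binomProb N q k := by
  rcases lt_or_eq_of_le hk with h | h
  · have hc := Nat.choose_succ_right_eq N k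
    have hc' : (N.choose (k + 1) : ℝ) * (k + 1) = N.choose k * ((N : ℝ) - k) := by
      rw [← Nat.cast_sub hk]; exact_mod_cast hc
    have e : N - k = (N - (k + 1)) + 1 := by omega
    unfold binomProb
    rw [e, pow_succ, pow_succ]
    linear_combination (q ^ k * q * (1 - q) ^ (N - (k + 1)) * (1 - q)) * hc'
  · subst h; rw [bp_zero_of_lt q (Nat.lt_succ_self k)]; simp

lemma bp_tail (N : ℕ) {q : ℝ} (h0 : 0 ≤ q) (h1 : q ≤ 1) (y : ℕ) (l : ℝ) (hl : |l| ≤ 1) :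
    binomProb N q y ≤ exp (-(l * y) + N * q * (l + l ^ 2)) := by
  have hexp : exp l ≤ 1 + l + l ^ 2 := by
    have := Real.abs_exp_sub_one_sub_id_le hl
    have := (abs_le.1 this).2
    linarith
  have key : binomProb N q y * exp l ^ y ≤ (q * exp l + (1 - q)) ^ N := by
    rcases lt_or_ge N y with h | h
    · rw [bp_zero_of_lt q h, zero_mul]
      have : 0 ≤ 1 - q := by linarith
      positivity
    · rw [add_pow]
      have := Finset.single_le_sum (f := fun i => (q * exp l) ^ i * (1 - q) ^ (N - i) * (N.choose i : ℝ))
        (s := Finset.range (N + 1)) (fun i _ => by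
          have : 0 ≤ 1 - q := by linarith
          positivity) (Finset.mem_range.2 (Nat.lt_succ_of_le h))
      refine le_trans (le_of_eq ?_) this
      simp only [binomProb, mul_pow]; ring
  have h2 : (q * exp l + (1 - q)) ^ N ≤ exp (N * q * (l + l ^ 2)) := by
    rw [mul_assoc, Real.exp_nat_mul]
    have hq : 0 ≤ 1 - q := by linarith
    apply pow_le_pow_left₀ (by positivity)
    have := Real.add_one_le_exp (q * (l + l ^ 2))
    nlinarith
  rw [← Real.exp_nat_mul] at key
  rw [Real.exp_add]
  have e : exp (-(l * y)) * exp (y * l) = 1 := by rw [← Real.exp_add]; ring_nf; simp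
  have hp := Real.exp_pos (-(l * y))
  calc binomProb N q y = exp (-(l * y)) * (binomProb N q y * exp (y * l)) := by
        linear_combination -(binomProb N q y) * e
    _ ≤ _ := mul_le_mul_of_nonneg_left (key.trans h2) hp.le

lemma exp_bd (a : ℝ) (ha : 0 < a) : exp (-(3 * a)) ≤ 2 / (a ^ 3) ^ 2 := by
  have h := Real.pow_div_factorial_le_exp (3 * a) (by positivity) 6
  rw [Real.exp_neg, inv_eq_one_div, div_le_div_iff₀ (Real.exp_pos _) (by positivity)]
  norm_num [Nat.factorial] at h
  nlinarith [pow_pos ha 6]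

/-- run argument -/
lemma run_bound (f : ℕ → ℝ) (d : ℝ) (L : ℕ) (hd : 0 ≤ d) (hd1 : d ≤ 1) (hf : 0 ≤ f 0)
    (hs : ∀ i < L, (1 - d) * f i ≤ f (i + 1)) (i : ℕ) (hi : i ≤ L) :
    (1 - i * d) * f 0 ≤ f i := by
  induction i with
  | zero => simp
  | succ i ih =>
    have h1 := ih (by omega)
    have h2 := hs i (by omega)
    have h3 := mul_le_mul_of_nonneg_left h1 (show 0 ≤ 1 - d by linarith)
    have h4 : 0 ≤ (i : ℝ) * d * d * f 0 := by positivity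
    push_cast
    nlinarith

set_option maxHeartbeats 2000000 in
lemma lemA (M : ℕ) (a p : ℝ) (ha : 0 < a) (ham : a ^ 3 = (M : ℝ) + 1) (h0 : 0 ≤ p) (h1 : p ≤ 2 / 3)
    (y : ℕ) :
    p * binomProb M p y ≤ 192 / a * cdfB M p y + 2 / ((M : ℝ) + 1) ^ 2 := by
  have hp1 : p ≤ 1 := by linarith
  have hb := bp_nonneg M h0 hp1 y
  have hF := cdfB_nonneg M h0 hp1 y
  have hbF := bp_le_cdfB M h0 hp1 y
  have hpos : 0 ≤ 2 / ((M : ℝ) + 1) ^ 2 := by positivity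
  have hposF : 0 ≤ 192 / a * cdfB M p y := by positivity
  rcases lt_or_ge M y with hy | hy
  · rw [bp_zero_of_lt p hy]; simp; linarith
  rcases le_or_gt (p * a) 48 with hpa | hpa
  · have : p ≤ 192 / a := by rw [le_div_iff₀ ha]; linarith
    have := mul_le_mul this hbF hb (by positivity)
    linarith
  have ha48 : 48 < a := by nlinarith
  rcases le_or_gt (y : ℝ) (a ^ 3 * p - 4 * a ^ 2) with ht | ht
  · have hl : |(-2 / a)| ≤ 1 := by
      rw [abs_le]; constructor
      · rw [le_div_iff₀ ha]; linarith
      · rw [div_le_iff₀ ha]; linarith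
    have := bp_tail M h0 hp1 y (-2 / a) hl
    have h3 : -((-2 / a) * (y : ℝ)) + M * p * (-2 / a + (-2 / a) ^ 2) ≤ -(3 * a) := by
      have hM : (M : ℝ) = a ^ 3 - 1 := by linarith
      rw [hM]
      have e : -((-2 / a) * (y : ℝ)) + (a ^ 3 - 1) * p * (-2 / a + (-2 / a) ^ 2)
         = (2 * y * a + (a ^ 3 - 1) * p * (-2 * a + 4)) / a ^ 2 := by field_simp; ring
      rw [e, div_le_iff₀ (by positivity)]
      have h5 : p * a ^ 3 ≤ 2 / 3 * a ^ 3 := by gcongr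
      have h6 : 48 * a ^ 2 ≤ a ^ 3 := by nlinarith [sq_nonneg a]
      nlinarith
    have h4 := this.trans ((Real.exp_le_exp.2 h3).trans (exp_bd a ha))
    rw [ham] at h4
    nlinarith
  -- run
  set L := ⌊p * a / 48⌋₊ with hL
  have hL1 : (L : ℝ) ≤ p * a / 48 := Nat.floor_le (by positivity)
  have hL2 : p * a / 48 < L + 1 := Nat.lt_floor_add_one _
  have hL3 : 1 ≤ L := by rw [hL, Nat.one_le_floor_iff]; linarith
  have hL3' : (1 : ℝ) ≤ L := by exact_mod_cast hL3
  have hLa : (L : ℝ) ≤ a := by nlinarith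
  have hpp : 0 < p := by nlinarith
  have hLy : L ≤ y := by
    have : (L : ℝ) ≤ y := by nlinarith [sq_nonneg a]
    exact_mod_cast this
  set d : ℝ := 24 / (a * p) with hd
  have hd0 : 0 ≤ d := by positivity
  have hdap : d * (a * p) = 24 := by rw [hd]; field_simp
  have hd1 : d ≤ 1 := by rw [hd, div_le_one (by positivity)]; linarith
  have hrun := run_bound (fun i => binomProb M p (y - i)) d L hd0 hd1 (bp_nonneg _ h0 hp1 _) (by
    intro i hi
    obtain ⟨k, hk⟩ : ∃ k, y - i = k + 1 := ⟨y - i - 1, by omega⟩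
    have hk' : y - (i + 1) = k := by omega
    rw [hk, hk']
    have hr := bp_ratio M p k (by omega)
    have hkr : (k : ℝ) + 1 = y - i := by
      have : k + 1 + i = y := by omega
      have : (k : ℝ) + 1 + i = y := by exact_mod_cast this
      linarith
    have hiL : (i : ℝ) ≤ L := by exact_mod_cast hi.le
    have hkM : (k : ℝ) + 1 ≤ M := by
      have : k + 1 ≤ M := by omega
      exact_mod_cast this
    have hlow : a ^ 3 * p - 8 * a ^ 2 ≤ (k : ℝ) + 1 := by nlinarith
    have hMk : (M : ℝ) - k = a ^ 3 - (k + 1) := by linarith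
    have hMkp : 0 < (M : ℝ) - k := by linarith
    have hineq : a ^ 3 * p - (k + 1) ≤ d * (((M : ℝ) - k) * p) := by
      rcases le_or_gt (a ^ 3 * p) (k + 1) with h | h
      · have : 0 ≤ d * (((M : ℝ) - k) * p) := by positivity
        linarith
      · have h8 : a ^ 3 / 3 ≤ (M : ℝ) - k := by
          rw [hMk]
          have := mul_le_mul_of_nonneg_left h1 (show 0 ≤ a ^ 3 by positivity)
          linarith
        have h9 : d * (a ^ 3 / 3 * p) ≤ d * (((M : ℝ) - k) * p) := by gcongr
        have h10 : d * (a ^ 3 / 3 * p) = 8 * a ^ 2 := by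
          linear_combination (a ^ 2 / 3) * hdap
        linarith
    have hb1 := bp_nonneg M h0 hp1 (k + 1)
    have h11 := mul_le_mul_of_nonneg_right hineq hb1
    have hc : 0 < ((M : ℝ) - k) * p := by positivity
    refine le_of_mul_le_mul_left ?_ hc
    rw [← hr]
    have : (a ^ 3 * p - (k + 1)) = ((M : ℝ) - k) * p - (k + 1) * (1 - p) := by rw [hMk]; ring
    rw [this] at h11
    nlinarith)
  have hhalf : ∀ i ∈ Finset.range L, binomProb M p y / 2 ≤ binomProb M p (y - i) := by
    intro i hi
    have hi' := Finset.mem_range.1 hi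
    have h := hrun i hi'.le
    simp only [Nat.sub_zero] at h
    have hiL : (i : ℝ) ≤ L := by exact_mod_cast hi'.le
    have : (i : ℝ) * d ≤ 1 / 2 := by
      calc (i : ℝ) * d ≤ (p * a / 48) * d := by gcongr; linarith
        _ = 1 / 2 := by linear_combination (1 / 48) * hdap
    have h12 := mul_le_mul_of_nonneg_right this hb
    linarith
  have hsum : (L : ℝ) * (binomProb M p y / 2) ≤ cdfB M p y := by
    have h1 := Finset.sum_le_sum hhalf
    rw [Finset.sum_const, Finset.card_range, nsmul_eq_mul] at h1
    refine h1.trans ?_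
    unfold cdfB
    rw [← Finset.sum_range_reflect (fun i => binomProb M p i) (y + 1)]
    have : ∀ i ∈ Finset.range (y + 1), binomProb M p (y + 1 - 1 - i) = binomProb M p (y - i) := by
      intro i _; rfl
    rw [Finset.sum_congr rfl this]
    apply Finset.sum_le_sum_of_subset_of_nonneg
    · intro x; simp; omega
    · intro i _ _; exact bp_nonneg _ h0 hp1 _
  have : p * binomProb M p y ≤ 192 / a * cdfB M p y := by
    have h2 : p * a ≤ 96 * L := by linarith
    rw [div_mul_eq_mul_div, le_div_iff₀ ha]
    nlinarith
  linarith

set_option maxHeartbeats 2000000 in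
lemma lemB (N : ℕ) (a q : ℝ) (ha : 200 ≤ a) (ham : a ^ 3 = (N : ℝ) + 1) (h0 : 0 ≤ q) (h1 : q ≤ 2 / 3)
    (y : ℕ) :
    q * binomProb N q y ≤ 192 / a * (1 - cdfB N q y) + 2 / ((N : ℝ) + 1) ^ 2 := by
  have hp1 : q ≤ 1 := by linarith
  have hapos : 0 < a := by linarith
  have hb := bp_nonneg N h0 hp1 y
  have hF := cdfB_le_one N h0 hp1 y
  have hpos : 0 ≤ 2 / ((N : ℝ) + 1) ^ 2 := by positivity
  have hposF : 0 ≤ 192 / a * (1 - cdfB N q y) := by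
    have : 0 ≤ 1 - cdfB N q y := by linarith
    positivity
  rcases lt_or_ge N y with hy | hy
  · rw [bp_zero_of_lt q hy]; simp; linarith
  rcases lt_or_ge (a ^ 3 * q + 4 * a ^ 2) ((y : ℝ) + 1) with ht | ht
  · have hl : |(2 / a)| ≤ 1 := by
      rw [abs_le]; constructor
      · rw [le_div_iff₀ hapos]; linarith
      · rw [div_le_iff₀ hapos]; linarith
    have := bp_tail N h0 hp1 y (2 / a) hl
    have h3 : -((2 / a) * (y : ℝ)) + N * q * (2 / a + (2 / a) ^ 2) ≤ -(3 * a) := by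
      have hM : (N : ℝ) = a ^ 3 - 1 := by linarith
      rw [hM]
      have e : -((2 / a) * (y : ℝ)) + (a ^ 3 - 1) * q * (2 / a + (2 / a) ^ 2)
         = (-2 * y * a + (a ^ 3 - 1) * q * (2 * a + 4)) / a ^ 2 := by field_simp; ring
      rw [e, div_le_iff₀ (by positivity)]
      have h5 : q * a ^ 3 ≤ 2 / 3 * a ^ 3 := by gcongr
      have h6 : 200 * a ^ 2 ≤ a ^ 3 := by nlinarith [sq_nonneg a]
      have h7 : 0 ≤ q * a := by positivity
      nlinarith
    have h4 := this.trans ((Real.exp_le_exp.2 h3).trans (exp_bd a hapos))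
    rw [ham] at h4
    nlinarith
  have hsq : 200 * a ^ 2 ≤ a ^ 3 := by nlinarith [sq_nonneg a]
  have hq3 : a ^ 3 * q ≤ a ^ 3 * (2 / 3) := by gcongr
  have hyN : y < N := by
    have : (y : ℝ) < N := by nlinarith
    exact_mod_cast this
  rcases le_or_gt (q * a) 48 with hpa | hpa
  · have hr := bp_ratio N q y hy
    have h5 : a ^ 3 * q ≤ 48 * a ^ 2 := by nlinarith [sq_nonneg a]
    have h6 : (y : ℝ) + 1 ≤ 52 * a ^ 2 := by linarith
    have h7 : a ^ 3 / 2 ≤ (N : ℝ) - y := by linarith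
    have hb1 := bp_nonneg N h0 hp1 (y + 1)
    have h8 : binomProb N q (y + 1) ≤ 1 - cdfB N q y := by
      have := cdfB_succ N q y
      have := cdfB_le_one N h0 hp1 (y + 1)
      linarith
    have h9 : a ^ 3 / 2 * (q * binomProb N q y) ≤ 52 * a ^ 2 * binomProb N q (y + 1) := by
      calc a ^ 3 / 2 * (q * binomProb N q y) ≤ ((N : ℝ) - y) * (q * binomProb N q y) := by gcongr
        _ = ((y : ℝ) + 1) * binomProb N q (y + 1) * (1 - q) := by linarith
        _ ≤ ((y : ℝ) + 1) * binomProb N q (y + 1) * 1 := by gcongr; linarith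
        _ ≤ 52 * a ^ 2 * binomProb N q (y + 1) := by rw [mul_one]; gcongr
    have h10 : q * binomProb N q y ≤ 192 / a * (1 - cdfB N q y) := by
      rw [div_mul_eq_mul_div, le_div_iff₀ hapos]
      have h11 : a ^ 2 * (a * (q * binomProb N q y)) ≤ a ^ 2 * (104 * binomProb N q (y + 1)) := by
        nlinarith
      have := le_of_mul_le_mul_left h11 (by positivity)
      nlinarith
    linarith
  set L := ⌊q * a / 48⌋₊ with hL
  have hL1 : (L : ℝ) ≤ q * a / 48 := Nat.floor_le (by positivity)
  have hL2 : q * a / 48 < L + 1 := Nat.lt_floor_add_one _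
  have hL3 : 1 ≤ L := by rw [hL, Nat.one_le_floor_iff]; linarith
  have hL3' : (1 : ℝ) ≤ L := by exact_mod_cast hL3
  have hLa : (L : ℝ) ≤ a := by nlinarith
  have hpp : 0 < q := by nlinarith
  set d : ℝ := 24 / (a * q) with hd
  have hd0 : 0 ≤ d := by positivity
  have hdap : d * (a * q) = 24 := by rw [hd]; field_simp
  have hd1 : d ≤ 1 := by rw [hd, div_le_one (by positivity)]; linarith
  have hrun := run_bound (fun i => binomProb N q (y + i)) d L hd0 hd1 (bp_nonneg _ h0 hp1 _) (by
    intro i hi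
    rw [← add_assoc]
    obtain ⟨k, hk⟩ : ∃ k, y + i = k := ⟨_, rfl⟩
    rw [hk]
    have hkr : (k : ℝ) = y + i := by exact_mod_cast hk.symm
    have hiL : (i : ℝ) ≤ L := by exact_mod_cast hi.le
    have hup : (k : ℝ) + 1 ≤ a ^ 3 * q + 8 * a ^ 2 := by nlinarith
    have hkN : k ≤ N := by
      have : (k : ℝ) ≤ N := by linarith
      exact_mod_cast this
    have hr := bp_ratio N q k hkN
    have hq1 : 1 / 3 ≤ 1 - q := by linarith
    have hq1' : 0 < 1 - q := by linarith
    have hineq : (k + 1) - a ^ 3 * q ≤ d * (((k : ℝ) + 1) * (1 - q)) := by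
      rcases le_or_gt ((k : ℝ) + 1) (a ^ 3 * q) with h | h
      · have : 0 ≤ d * (((k : ℝ) + 1) * (1 - q)) := by positivity
        linarith
      · have h9 : d * (a ^ 3 * q * (1 / 3)) ≤ d * (((k : ℝ) + 1) * (1 - q)) := by gcongr
        have h10 : d * (a ^ 3 * q * (1 / 3)) = 8 * a ^ 2 := by
          linear_combination (a ^ 2 / 3) * hdap
        linarith
    have hb1 := bp_nonneg N h0 hp1 k
    have h11 := mul_le_mul_of_nonneg_right hineq hb1
    have hc : 0 < ((k : ℝ) + 1) * (1 - q) := by positivity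
    refine le_of_mul_le_mul_left ?_ hc
    rw [hr]
    have : ((k + 1) - a ^ 3 * q) = ((k : ℝ) + 1) * (1 - q) - ((N : ℝ) - k) * q := by rw [ham]; ring
    rw [this] at h11
    nlinarith)
  have hhalf : ∀ i ≤ L, binomProb N q y / 2 ≤ binomProb N q (y + i) := by
    intro i hi'
    have h := hrun i hi'
    simp only [Nat.add_zero] at h
    have hiL : (i : ℝ) ≤ L := by exact_mod_cast hi'
    have : (i : ℝ) * d ≤ 1 / 2 := by
      calc (i : ℝ) * d ≤ (q * a / 48) * d := by gcongr; linarith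
        _ = 1 / 2 := by linear_combination (1 / 48) * hdap
    have h12 := mul_le_mul_of_nonneg_right this hb
    linarith
  have hsum : ∀ i ≤ L, cdfB N q y + (i : ℝ) * (binomProb N q y / 2) ≤ cdfB N q (y + i) := by
    intro i
    induction i with
    | zero => simp
    | succ i ih =>
      intro hi
      have h1 := ih (by omega)
      have h2 := hhalf (i + 1) hi
      rw [← add_assoc] at h2 ⊢
      rw [cdfB_succ]
      push_cast
      linarith
  have hs := (hsum L le_rfl).trans (cdfB_le_one N h0 hp1 _)
  have : q * binomProb N q y ≤ 192 / a * (1 - cdfB N q y) := by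
    have h2 : q * a ≤ 96 * L := by linarith
    rw [div_mul_eq_mul_div, le_div_iff₀ hapos]
    nlinarith
  linarith

lemma lemB_small (N : ℕ) (q : ℝ) (h0 : 0 ≤ q) (h1 : q ≤ 1) (y : ℕ) :
    q * binomProb N q y ≤ ((N : ℝ) + 1) * (1 - cdfB N q y) + (if y = N then q ^ (N + 1) else 0) := by
  have hF := cdfB_le_one N h0 h1 y
  have hF' : 0 ≤ ((N : ℝ) + 1) * (1 - cdfB N q y) := mul_nonneg (by positivity) (by linarith)
  rcases lt_trichotomy y N with hy | hy | hy
  · rw [if_neg hy.ne, add_zero]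
    have hr := bp_ratio N q y hy.le
    have hb := bp_nonneg N h0 h1 y
    have hb1 := bp_nonneg N h0 h1 (y + 1)
    have h8 : binomProb N q (y + 1) ≤ 1 - cdfB N q y := by
      have := cdfB_succ N q y
      have := cdfB_le_one N h0 h1 (y + 1)
      linarith
    have hyN : (y : ℝ) + 1 ≤ N := by exact_mod_cast hy
    calc q * binomProb N q y = 1 * (q * binomProb N q y) := by ring
      _ ≤ ((N : ℝ) - y) * (q * binomProb N q y) := by gcongr; linarith
      _ = ((y : ℝ) + 1) * binomProb N q (y + 1) * (1 - q) := by linarith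
      _ ≤ ((y : ℝ) + 1) * binomProb N q (y + 1) * 1 := by gcongr; linarith
      _ ≤ ((N : ℝ) + 1) * (1 - cdfB N q y) := by rw [mul_one]; gcongr
  · subst hy
    rw [if_pos rfl]
    have : q * binomProb y q y = q ^ (y + 1) := by simp [binomProb, pow_succ]; ring
    linarith
  · rw [bp_zero_of_lt q hy, if_neg hy.ne']; simpa using hF'

lemma pow23 (n : ℕ) (hn : 2 ≤ n) : (2 / 3 : ℝ) ^ n / 2 ≤ 2 / (n : ℝ) ^ 2 := by
  have hpos : (0 : ℝ) < n := by positivity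
  rw [div_le_div_iff₀ (by norm_num) (by positivity)]
  rcases lt_or_ge n 5 with h | h
  · interval_cases n <;> norm_num
  · clear hn hpos
    induction n, h using Nat.le_induction with
    | base => norm_num
    | succ n hn ih =>
      have h5 : (5 : ℝ) ≤ n := by exact_mod_cast hn
      have : (2 / 3 : ℝ) * ((n : ℝ) + 1) ^ 2 ≤ n ^ 2 := by nlinarith
      have h2 := mul_le_mul_of_nonneg_left this (show (0 : ℝ) ≤ (2 / 3) ^ n by positivity)
      rw [pow_succ]; push_cast; nlinarith

lemma corner (m n : ℕ) (p q : ℝ) (hm : 2 ≤ m) (hn : 2 ≤ n) (h0 : 0 ≤ q) (hqp : q ≤ p) (h1 : p ≤ 2 / 3) :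
    binomProb m p n * q ^ n ≤ 2 / (n : ℝ) ^ 2 := by
  refine le_trans ?_ (pow23 n hn)
  obtain ⟨m, rfl⟩ : ∃ k, m = k + 1 + 1 := ⟨m - 2, by omega⟩
  obtain ⟨n, rfl⟩ : ∃ k, n = k + 1 + 1 := ⟨n - 2, by omega⟩
  have hp0 : 0 ≤ p := by linarith
  have hp1 : p ≤ 1 := by linarith
  have e : binomProb (m + 1 + 1) p (n + 1 + 1) = p ^ 2 * binomProb m p n
      + 2 * p * (1 - p) * binomProb m p (n + 1) + (1 - p) ^ 2 * binomProb m p (n + 1 + 1) := by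
    rw [bp_succ, bp_succ, bp_succ]; ring
  have hs : binomProb m p n + binomProb m p (n + 1) + binomProb m p (n + 1 + 1) ≤ 1 := by
    have h1 := cdfB_succ m p n
    have h2 := cdfB_succ m p (n + 1)
    have h3 := cdfB_le_one m hp0 hp1 (n + 1 + 1)
    have h4 := bp_le_cdfB m hp0 hp1 n
    linarith
  have hw : 0 ≤ (2 / 3 : ℝ) ^ (n + 1 + 1) := by positivity
  have hqn : q ^ (n + 1 + 1) ≤ (2 / 3) ^ (n + 1 + 1) := by gcongr; linarith
  have hq0 : 0 ≤ q ^ (n + 1 + 1) := by positivity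
  have c1 : p ^ 2 * q ^ (n + 1 + 1) ≤ (2 / 3) ^ (n + 1 + 1) / 2 := by
    have : p ^ 2 ≤ 1 / 2 := by nlinarith
    nlinarith
  have c2 : 2 * p * (1 - p) * q ^ (n + 1 + 1) ≤ (2 / 3) ^ (n + 1 + 1) / 2 := by
    have : 2 * p * (1 - p) ≤ 1 / 2 := by nlinarith [sq_nonneg (p - 1 / 2)]
    nlinarith
  have c3 : (1 - p) ^ 2 * q ^ (n + 1 + 1) ≤ (2 / 3) ^ (n + 1 + 1) / 2 := by
    have h1' : q ^ (n + 1 + 1) ≤ (2 / 3) ^ n * p ^ 2 := by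
      calc q ^ (n + 1 + 1) = q ^ n * q ^ 2 := by ring
        _ ≤ (2 / 3) ^ n * p ^ 2 := by gcongr; linarith
    have h2 : (1 - p) ^ 2 * p ^ 2 ≤ 1 / 16 := by
      have ha : 0 ≤ p * (1 - p) := mul_nonneg hp0 (by linarith)
      have hb : p * (1 - p) ≤ 1 / 4 := by nlinarith [sq_nonneg (p - 1 / 2)]
      nlinarith
    have h3 : (0 : ℝ) ≤ (2 / 3) ^ n := by positivity
    calc (1 - p) ^ 2 * q ^ (n + 1 + 1) ≤ (1 - p) ^ 2 * ((2 / 3) ^ n * p ^ 2) := by gcongr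
      _ = (2 / 3) ^ n * ((1 - p) ^ 2 * p ^ 2) := by ring
      _ ≤ (2 / 3) ^ n * (1 / 16) := by gcongr
      _ ≤ (2 / 3) ^ (n + 1 + 1) / 2 := by rw [pow_succ, pow_succ]; linarith
  have b1 := bp_nonneg m hp0 hp1 n
  have b2 := bp_nonneg m hp0 hp1 (n + 1)
  have b3 := bp_nonneg m hp0 hp1 (n + 1 + 1)
  rw [e]
  have d1 := mul_le_mul_of_nonneg_right c1 b1
  have d2 := mul_le_mul_of_nonneg_right c2 b2
  have d3 := mul_le_mul_of_nonneg_right c3 b3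
  have d4 := mul_le_mul_of_nonneg_left hs (show 0 ≤ (2 / 3 : ℝ) ^ (n + 1 + 1) / 2 by positivity)
  linarith

lemma prGE_nonneg (m : ℕ) (p : ℝ) (n : ℕ) (q : ℝ) (hp0 : 0 ≤ p) (hp1 : p ≤ 1) (hq0 : 0 ≤ q)
    (hq1 : q ≤ 1) : 0 ≤ prGE m p n q := by
  rw [prGE_eq_F]
  exact Finset.sum_nonneg fun k _ => mul_nonneg (bp_nonneg _ hq0 hq1 _) (cdfB_nonneg _ hp0 hp1 _)

lemma left_ineq (M n : ℕ) (p q a C : ℝ) (ha : 0 < a) (ham : a ^ 3 = (M : ℝ) + 1) (hq0 : 0 ≤ q)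
    (hqp : q ≤ p) (h1 : p ≤ 2 / 3) (hC : 192 ≤ C) :
    (1 - C * a⁻¹) * prGE M p n q - 2 / ((M : ℝ) + 1) ^ 2 ≤ prGE (M + 1) p n q := by
  have hp0 : 0 ≤ p := by linarith
  have hnn := prGE_nonneg M p n q hp0 (by linarith) hq0 (by linarith)
  have h192 : 192 / a * prGE M p n q ≤ C * a⁻¹ * prGE M p n q := by
    rw [div_eq_mul_inv]; gcongr
  have key : prGE M p n q - prGE (M + 1) p n q
      ≤ 192 / a * prGE M p n q + 2 / ((M : ℝ) + 1) ^ 2 := by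
    rw [prGE_eq_F, prGE_eq_F, ← Finset.sum_sub_distrib, Finset.mul_sum]
    have e : 2 / ((M : ℝ) + 1) ^ 2
        = ∑ k ∈ Finset.range (n + 1), 2 / ((M : ℝ) + 1) ^ 2 * binomProb n q k := by
      rw [← Finset.mul_sum, bp_sum, mul_one]
    rw [e, ← Finset.sum_add_distrib]
    apply Finset.sum_le_sum
    intro k _
    rw [cdfB_step]
    have := mul_le_mul_of_nonneg_left (lemA M a p ha ham hp0 h1 k)
      (bp_nonneg n hq0 (show q ≤ 1 by linarith) k)
    linarith
  linarith

lemma right_ineq (m N : ℕ) (p q a C : ℝ) (hm : 2 ≤ m) (hN : 1 ≤ N) (ha : 0 < a)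
    (ham : a ^ 3 = (N : ℝ) + 1) (hq0 : 0 ≤ q)
    (hqp : q ≤ p) (h1 : p ≤ 2 / 3) (hC : 200 ^ 4 ≤ C) :
    prGE m p (N + 1) q ≤ (1 + C * a⁻¹) * prGE m p N q + 2 / ((N : ℝ) + 1) ^ 2 := by
  have hp0 : 0 ≤ p := by linarith
  have hp1 : p ≤ 1 := by linarith
  have hq1 : q ≤ 1 := by linarith
  have hdiff : prGE m p (N + 1) q - prGE m p N q
      = ∑ j ∈ Finset.range m, binomProb m p (j + 1) * (q * binomProb N q j) := by
    rw [prGE_eq_G, prGE_eq_G, add_sub_add_left_eq_sub, ← Finset.sum_sub_distrib]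
    apply Finset.sum_congr rfl
    intro j _
    rw [cdfB_step]; ring
  have hG : ∑ j ∈ Finset.range m, binomProb m p (j + 1) * (1 - cdfB N q j) ≤ prGE m p N q := by
    rw [prGE_eq_G]; linarith [bp_nonneg m hp0 hp1 0]
  have hnn := prGE_nonneg m p N q hp0 hp1 hq0 hq1
  rcases le_or_gt 200 a with h | h
  · have h192 : 192 / a * prGE m p N q ≤ C * a⁻¹ * prGE m p N q := by
      rw [div_eq_mul_inv]; gcongr; linarith
    have hS : ∑ j ∈ Finset.range m, binomProb m p (j + 1) ≤ 1 := by
      have := bp_sum m p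
      rw [Finset.sum_range_succ'] at this
      linarith [bp_nonneg m hp0 hp1 0]
    have : ∑ j ∈ Finset.range m, binomProb m p (j + 1) * (q * binomProb N q j) ≤
        192 / a * ∑ j ∈ Finset.range m, binomProb m p (j + 1) * (1 - cdfB N q j)
        + 2 / ((N : ℝ) + 1) ^ 2 * ∑ j ∈ Finset.range m, binomProb m p (j + 1) := by
      rw [Finset.mul_sum, Finset.mul_sum, ← Finset.sum_add_distrib]
      apply Finset.sum_le_sum
      intro j _
      have := mul_le_mul_of_nonneg_left (lemB N a q h ham hq0 (by linarith) j)
        (bp_nonneg m hp0 hp1 (j + 1))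
      linarith
    have h2 := mul_le_mul_of_nonneg_left hG (show 0 ≤ 192 / a by positivity)
    have h3 := mul_le_mul_of_nonneg_left hS (show 0 ≤ 2 / ((N : ℝ) + 1) ^ 2 by positivity)
    linarith
  · have hCa : (N : ℝ) + 1 ≤ C * a⁻¹ := by
      rw [← ham, ← div_eq_mul_inv, le_div_iff₀ ha, ← pow_succ]
      refine le_trans ?_ hC
      gcongr
    have hc := corner m (N + 1) p q hm (by omega) hq0 hqp h1
    push_cast at hc
    have : ∑ j ∈ Finset.range m, binomProb m p (j + 1) * (q * binomProb N q j) ≤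
        ((N : ℝ) + 1) * ∑ j ∈ Finset.range m, binomProb m p (j + 1) * (1 - cdfB N q j)
        + ∑ j ∈ Finset.range m, (if j = N then binomProb m p (N + 1) * q ^ (N + 1) else 0) := by
      rw [Finset.mul_sum, ← Finset.sum_add_distrib]
      apply Finset.sum_le_sum
      intro j _
      have := mul_le_mul_of_nonneg_left (lemB_small N q hq0 hq1 j)
        (bp_nonneg m hp0 hp1 (j + 1))
      split_ifs at this ⊢ with hj
      · subst hj; linarith
      · linarith
    have h2 := mul_le_mul_of_nonneg_left hG (show 0 ≤ (N : ℝ) + 1 by positivity)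
    have h3 := mul_le_mul_of_nonneg_right hCa hnn
    have h4 : ∑ j ∈ Finset.range m, (if j = N then binomProb m p (N + 1) * q ^ (N + 1) else 0)
        ≤ 2 / ((N : ℝ) + 1) ^ 2 := by
      rw [Finset.sum_ite_eq']
      split_ifs
      · exact hc
      · positivity
    linarith

lemma cube_root (m : ℕ) (hm : 2 ≤ m) : ∃ a : ℝ, 0 < a ∧ a ^ 3 = m ∧
    (m : ℝ) ^ (-(1 / 3) : ℝ) = a⁻¹ := by
  have h : (0 : ℝ) < m := by positivity
  refine ⟨(m : ℝ) ^ (1 / 3 : ℝ), by positivity, ?_, Real.rpow_neg h.le _⟩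
  rw [← Real.rpow_natCast, ← Real.rpow_mul h.le]; norm_num

theorem one_less_trial :
    ∃ C : ℝ, 0 < C ∧ ∀ (m n : ℕ) (p q : ℝ),
      2 ≤ m → 2 ≤ n → 0 ≤ p → p ≤ 2 / 3 → 0 ≤ q → q ≤ 2 / 3 →
      (1 - C * (m : ℝ) ^ (-(1 / 3) : ℝ)) * Pmn (m - 1) n p q - 2 / (m : ℝ) ^ 2
          ≤ Pmn m n p q ∧
        Pmn m n p q
          ≤ (1 + C * (n : ℝ) ^ (-(1 / 3) : ℝ)) * Pmn m (n - 1) p q + 2 / (n : ℝ) ^ 2 := by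
  refine ⟨200 ^ 4, by norm_num, ?_⟩
  intro m n p q hm hn hp0 hp1 hq0 hq1
  have h0 : 0 ≤ min p q := le_min hp0 hq0
  have h1 : max p q ≤ 2 / 3 := max_le hp1 hq1
  have h2 : min p q ≤ max p q := min_le_max
  unfold Pmn
  constructor
  · obtain ⟨a, ha, ham, e⟩ := cube_root m hm
    obtain ⟨M, rfl⟩ : ∃ k, m = k + 1 := ⟨m - 1, by omega⟩
    rw [e]
    push_cast at ham ⊢
    exact left_ineq M n _ _ a _ ha ham h0 h2 h1 (by norm_num)
  · obtain ⟨a, ha, ham, e⟩ := cube_root n hn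
    obtain ⟨N, rfl⟩ : ∃ k, n = k + 1 := ⟨n - 1, by omega⟩
    rw [e]
    push_cast at ham ⊢
    exact right_ineq m N _ _ a _ hm (by omega) ha ham h0 h2 h1 (by norm_num)
end

section
/- For all n₁, n₂ ∈ ℕ and all p, q ∈ [0,1], P(n₁ + n₂, p, q) ≥ P(n₁, p, q) · P(n₂, p, q). -/
open Real Filter

/-- Expectation of `f` under Binomial(n, a). -/
noncomputable def binE (n : ℕ) (a : ℝ) (f : ℕ → ℝ) : ℝ :=
  ∑ k ∈ Finset.range (n + 1), binomProb n a k * f k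

lemma binomProb_succ (n : ℕ) (a : ℝ) (k : ℕ) :
    binomProb (n + 1) a (k + 1) = a * binomProb n a k + (1 - a) * binomProb n a (k + 1) := by
  unfold binomProb
  rw [Nat.choose_succ_succ, Nat.add_sub_add_right]
  rcases Nat.lt_or_ge k n with h | h
  · obtain ⟨d, rfl⟩ : ∃ d, n = k + 1 + d := ⟨n - (k + 1), by omega⟩
    have h1 : k + 1 + d - k = d + 1 := by omega
    have h2 : k + 1 + d - (k + 1) = d := by omega
    rw [h1, h2]
    push_cast
    ring
  · rw [Nat.choose_eq_zero_of_lt (show n < k + 1 by omega)]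
    push_cast
    ring

lemma binomProb_top (n : ℕ) (a : ℝ) : binomProb n a (n + 1) = 0 := by
  simp [binomProb]

lemma binE_succ (n : ℕ) (a : ℝ) (f : ℕ → ℝ) :
    binE (n + 1) a f = a * binE n a (fun k => f (k + 1)) + (1 - a) * binE n a f := by
  have h0 : binomProb (n + 1) a 0 = (1 - a) * binomProb n a 0 := by
    simp [binomProb, pow_succ]
    ring
  have h1 : binE n a f
      = ∑ k ∈ Finset.range (n + 1), binomProb n a (k + 1) * f (k + 1) + binomProb n a 0 * f 0 := by
    rw [← Finset.sum_range_succ' (fun k => binomProb n a k * f k), Finset.sum_range_succ,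
      binomProb_top]
    simp [binE]
  rw [h1]
  unfold binE
  rw [Finset.sum_range_succ', h0, mul_add, Finset.mul_sum, Finset.mul_sum, ← add_assoc,
    ← Finset.sum_add_distrib]
  congr 1
  · apply Finset.sum_congr rfl
    intro k _
    rw [binomProb_succ]
    ring
  · ring

lemma binE_zero (a : ℝ) (f : ℕ → ℝ) : binE 0 a f = f 0 := by
  simp [binE, binomProb]

lemma binE_add (m n : ℕ) (a : ℝ) (f : ℕ → ℝ) :
    binE (m + n) a f = binE m a (fun i => binE n a (fun j => f (i + j))) := by
  induction m generalizing f with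
  | zero => simp [binE_zero]
  | succ m ih =>
    rw [show m + 1 + n = (m + n) + 1 by omega, binE_succ, binE_succ, ih, ih]
    simp only [add_right_comm]

lemma binE_mul_left (n : ℕ) (a c : ℝ) (f : ℕ → ℝ) :
    binE n a (fun k => c * f k) = c * binE n a f := by
  unfold binE
  rw [Finset.mul_sum]
  exact Finset.sum_congr rfl fun k _ => by ring

lemma binE_mul_right (n : ℕ) (a c : ℝ) (f : ℕ → ℝ) :
    binE n a (fun k => f k * c) = binE n a f * c := by
  unfold binE
  rw [Finset.sum_mul]
  exact Finset.sum_congr rfl fun k _ => by ring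

lemma binE_mono (n : ℕ) (a : ℝ) (h0 : 0 ≤ a) (h1 : a ≤ 1) (f g : ℕ → ℝ) (h : ∀ k, f k ≤ g k) :
    binE n a f ≤ binE n a g := by
  unfold binE
  have h2 : 0 ≤ 1 - a := by linarith
  refine Finset.sum_le_sum fun k _ => mul_le_mul_of_nonneg_left (h k) ?_
  unfold binomProb
  positivity

lemma Pn_eq_s9 (n : ℕ) (p q : ℝ) :
    Pn n p q = binE n (max p q) (fun j => binE n (min p q) (fun k => if j ≤ k then 1 else 0)) := by
  unfold Pn Pmn prGE prGEshift binE
  refine Finset.sum_congr rfl fun j _ => ?_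
  rw [Finset.mul_sum]
  refine Finset.sum_congr rfl fun k _ => ?_
  simp

theorem P_superadditive
    (n₁ n₂ : ℕ) (p q : ℝ) (hp0 : 0 ≤ p) (hp1 : p ≤ 1) (hq0 : 0 ≤ q) (hq1 : q ≤ 1) :
    Pn n₁ p q * Pn n₂ p q ≤ Pn (n₁ + n₂) p q := by
  have ha0 : 0 ≤ max p q := le_max_of_le_left hp0
  have ha1 : max p q ≤ 1 := max_le hp1 hq1
  have hb0 : 0 ≤ min p q := le_min hp0 hq0
  have hb1 : min p q ≤ 1 := min_le_of_left_le hp1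
  simp only [Pn_eq_s9]
  rw [← binE_mul_right, binE_add]
  refine binE_mono _ _ ha0 ha1 _ _ fun i₁ => ?_
  rw [← binE_mul_left]
  refine binE_mono _ _ ha0 ha1 _ _ fun i₂ => ?_
  rw [← binE_mul_right, binE_add]
  refine binE_mono _ _ hb0 hb1 _ _ fun k₁ => ?_
  rw [← binE_mul_left]
  refine binE_mono _ _ hb0 hb1 _ _ fun k₂ => ?_
  by_cases h1 : i₁ ≤ k₁ <;> by_cases h2 : i₂ ≤ k₂
  · simp [h1, h2, add_le_add h1 h2]
  all_goals
    simp only [h1, h2, if_true, if_false, mul_zero, zero_mul]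
    split_ifs <;> norm_num
end
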